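/- arXiv:2210.12665 — 4 statements merged into one kernel-verified Lean document; each statement's English description precedes it below -/
import Mathlib

section
/- Let P be a closed path polyomino and K a field. Then the polyomino ideal I_P is of König type. -/
open scoped MonomialOrder

/-- A cell of `ℤ²`, identified with its lower-left corner. -/
abbrev Cell : Type := ℤ × ℤ

/-- The four vertices of a cell. -/
def cellVerts (c : Cell) : Finset Cell :=
  {c, (c.1 + 1, c.2), (c.1, c.2 + 1), (c.1 + 1, c.2 + 1)}

/-- Two cells are edge-adjacent if their lower-left corners differ by `(±1,0)` or `(0,±1)`. -/
def EdgeAdj (c d : Cell) : Prop :=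
  (c.1 = d.1 ∧ (c.2 = d.2 + 1 ∨ d.2 = c.2 + 1)) ∨
  (c.2 = d.2 ∧ (c.1 = d.1 + 1 ∨ d.1 = c.1 + 1))

/-- `L` is a path of cells from `C` to `D`, all cells lying in `S`:
consecutive cells are edge-adjacent and all cells are distinct. -/
def IsCellPath (S : Set Cell) (C D : Cell) (L : List Cell) : Prop :=
  L.head? = some C ∧ L.getLast? = some D ∧
  L.Chain' EdgeAdj ∧ L.Nodup ∧ ∀ c ∈ L, c ∈ S

/-- A polyomino: a finite nonempty collection of cells, any two of which are
connected by a path of cells of the collection. -/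
def IsPolyomino (P : Finset Cell) : Prop :=
  P.Nonempty ∧ ∀ C ∈ P, ∀ D ∈ P, ∃ L, IsCellPath (↑P) C D L

/-- The vertex set `V(P)` of a collection of cells. -/
def polyVerts (P : Finset Cell) : Finset Cell := P.biUnion cellVerts

/-- `A : ZMod n → Cell` realizes `P` as a closed path of cells:
consecutive cells (cyclically) share an edge, all cells are distinct, cells that are
not cyclically within distance 2 share no vertex, and `P` is the set of cells of the sequence. -/
def IsClosedPathSeq (n : ℕ) (A : ZMod n → Cell) (P : Finset Cell) : Prop :=
  (∀ i, EdgeAdj (A i) (A (i + 1))) ∧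
  Function.Injective A ∧
  (∀ i j : ZMod n, j ∉ ({i - 2, i - 1, i, i + 1, i + 2} : Set (ZMod n)) →
    cellVerts (A i) ∩ cellVerts (A j) = ∅) ∧
  (P : Set Cell) = Set.range A

/-- A closed path polyomino. -/
def IsClosedPath (P : Finset Cell) : Prop :=
  ∃ n : ℕ, 5 < n ∧ ∃ A : ZMod n → Cell, IsClosedPathSeq n A P
/-- `[a,b]` is an inner interval of `P`: it is a proper interval of `ℤ²` and every cell
of `ℤ²` contained in it belongs to `P`. -/
def IsInnerInterval (P : Finset Cell) (a b : Cell) : Prop :=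
  a.1 < b.1 ∧ a.2 < b.2 ∧
  ∀ c : Cell, a.1 ≤ c.1 → c.1 + 1 ≤ b.1 → a.2 ≤ c.2 → c.2 + 1 ≤ b.2 → c ∈ P

/-- The inner 2-minors of `P` : for each inner interval `[a,b]` of `P` with diagonal
corners `a, b` and anti-diagonal corners `c, d`, the binomial `x_a x_b - x_c x_d`. -/
def innerMinors (K : Type*) [Field K] (P : Finset Cell) :
    Set (MvPolynomial {v // v ∈ polyVerts P} K) :=
  { f | ∃ a b c d : {v // v ∈ polyVerts P},
      IsInnerInterval P (a : Cell) (b : Cell) ∧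
      (c : Cell) = ((a : Cell).1, (b : Cell).2) ∧
      (d : Cell) = ((b : Cell).1, (a : Cell).2) ∧
      f = MvPolynomial.X a * MvPolynomial.X b - MvPolynomial.X c * MvPolynomial.X d }

/-- The polyomino ideal `I_P ⊆ S_P = K[x_v : v ∈ V(P)]`, generated by the
inner 2-minors of `P`. -/
noncomputable def polyIdeal (K : Type*) [Field K] (P : Finset Cell) :
    Ideal (MvPolynomial {v // v ∈ polyVerts P} K) :=
  Ideal.span (innerMinors K P)

/-- The height of an ideal: the infimum of the heights of the prime ideals containing it. -/
noncomputable def idealHeight {R : Type*} [CommRing R] (I : Ideal R) : ℕ∞ :=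
  ⨅ (p : PrimeSpectrum R) (_ : I ≤ p.asIdeal), Order.height p

universe u₁ u₂ u₃

/-- `g` is the initial term of `f` with respect to the monomial order `m`. -/
def IsInitialTerm {σ : Type u₁} {K : Type u₂} [Field K] (m : MonomialOrder.{u₁, u₃} σ)
    (f g : MvPolynomial σ K) : Prop :=
  ∃ d ∈ f.support, (∀ e ∈ f.support, e ≼[m] d) ∧
    g = MvPolynomial.monomial d (MvPolynomial.coeff d f)

/-- A graded ideal `I` of a polynomial ring is of König type if, with `h` the height of
`I`, there are homogeneous polynomials `f 0, …, f (h-1)` forming part of a minimal system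
of homogeneous generators of `I` and a monomial order such that the corresponding initial
terms form a regular sequence. -/
def IsKoenigType {σ : Type u₁} {K : Type u₂} [Field K] (I : Ideal (MvPolynomial σ K)) : Prop :=
  ∃ h : ℕ, idealHeight I = (h : ℕ∞) ∧
    ∃ (f : Fin h → MvPolynomial σ K) (G : Set (MvPolynomial σ K)),
      Function.Injective f ∧ (∀ i, f i ∈ G) ∧
      (∀ g ∈ G, ∃ n, MvPolynomial.IsHomogeneous g n) ∧
      Ideal.span G = I ∧ (∀ g ∈ G, Ideal.span (G \ {g}) ≠ I) ∧
      ∃ (m : MonomialOrder.{u₁, u₁} σ) (ini : Fin h → MvPolynomial σ K),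
        (∀ i, IsInitialTerm m (f i) (ini i)) ∧
        RingTheory.Sequence.IsRegular (MvPolynomial σ K) (List.ofFn ini)
section KoenigAlgebra

variable {σ : Type u₁} {K : Type u₂} [Field K]

/-- partial ideals -/
def partIdeal {R : Type*} [CommRing R] (f : ℕ → R) (k : ℕ) : Ideal R :=
  Ideal.span (f '' Set.Iio k)

lemma partIdeal_mono {R : Type*} [CommRing R] (f : ℕ → R) {j k : ℕ} (h : j ≤ k) :
    partIdeal f j ≤ partIdeal f k :=
  Ideal.span_mono (Set.image_mono (Set.Iio_subset_Iio h))

lemma partIdeal_succ {R : Type*} [CommRing R] (f : ℕ → R) (k : ℕ) :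
    partIdeal f (k+1) = Ideal.span {f k} ⊔ partIdeal f k := by
  unfold partIdeal
  rw [← Ideal.span_union]
  congr 1
  ext x
  simp only [Set.mem_image, Set.mem_Iio, Set.singleton_union, Set.mem_insert_iff]
  constructor
  · rintro ⟨j, hj, rfl⟩
    rcases Nat.lt_succ_iff_lt_or_eq.mp hj with h | h
    · exact Or.inr ⟨j, h, rfl⟩
    · exact Or.inl (by rw [h])
  · rintro (h | ⟨j, hj, rfl⟩)
    · exact ⟨k, Nat.lt_succ_self k, h.symm⟩
    · exact ⟨j, by omega, rfl⟩

lemma exists_reduced (m : MonomialOrder.{u₁, u₃} σ) (f : ℕ → MvPolynomial σ K) (k : ℕ)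
    (h0 : ∀ i < k, f i ≠ 0) (g : MvPolynomial σ K) :
    ∃ r, g - r ∈ partIdeal f k ∧ ∀ c ∈ r.support, ∀ i < k, ¬ m.degree (f i) ≤ c := by
  obtain ⟨q, r, h1, -, h3⟩ := m.div_set (B := f '' Set.Iio k) (by
    rintro _ ⟨i, hi, rfl⟩
    rw [isUnit_iff_ne_zero]
    exact m.leadingCoeff_ne_zero_iff.mpr (h0 i hi)) g
  refine ⟨r, ?_, fun c hc i hi => h3 c hc _ ⟨i, hi, rfl⟩⟩
  rw [h1, add_sub_cancel_right]
  unfold partIdeal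
  rw [Finsupp.linearCombination_apply, Finsupp.sum]
  refine Ideal.sum_mem _ fun b _ => ?_
  exact Ideal.mul_mem_left _ _ (Ideal.subset_span b.2)

lemma le_of_le_add_disjoint {a u v : σ →₀ ℕ} (h : a ≤ u + v) (hd : Disjoint a.support v.support) :
    a ≤ u := by
  intro x
  have := h x
  by_cases hx : x ∈ a.support
  · have := Finset.disjoint_left.mp hd hx
    simp at this
    simp_all
  · simp at hx
    simp [hx]

lemma degree_mem_of_partIdeal (m : MonomialOrder.{u₁, u₃} σ) (f : ℕ → MvPolynomial σ K) (h : ℕ)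
    (h0 : ∀ i < h, f i ≠ 0)
    (hd : ∀ i < h, ∀ j < h, i ≠ j → Disjoint (m.degree (f i)).support (m.degree (f j)).support) :
    ∀ k ≤ h, ∀ x ∈ partIdeal f k, x ≠ 0 → ∃ i < k, m.degree (f i) ≤ m.degree x := by
  intro k
  induction k with
  | zero =>
    intro _ x hx hx0
    simp [partIdeal] at hx
    exact absurd hx hx0
  | succ k ih =>
    intro hk x hx hx0
    rw [partIdeal_succ, Submodule.mem_sup] at hx
    obtain ⟨y, hy, z, hz, rfl⟩ := hx
    obtain ⟨g, rfl⟩ := Ideal.mem_span_singleton'.mp hy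
    obtain ⟨r, hr1, hr2⟩ := exists_reduced m f k (fun i hi => h0 i (by omega)) g
    have hz' : z + (g - r) * f k ∈ partIdeal f k :=
      Ideal.add_mem _ hz (Ideal.mul_mem_right _ _ hr1)
    have hx : g * f k + z = r * f k + (z + (g - r) * f k) := by ring
    rw [hx] at hx0 ⊢
    generalize z + (g - r) * f k = w at *
    by_cases hr0 : r = 0
    · subst hr0
      simp only [zero_mul, zero_add] at hx0 ⊢
      obtain ⟨i, hi, hh⟩ := ih (by omega) w hz' hx0
      exact ⟨i, by omega, hh⟩
    · have hfk := h0 k (by omega)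
      have hdeg : m.degree (r * f k) = m.degree r + m.degree (f k) := m.degree_mul hr0 hfk
      by_cases hw0 : w = 0
      · refine ⟨k, by omega, ?_⟩
        rw [hw0, add_zero, hdeg]
        exact le_add_self
      · obtain ⟨i, hi, hh⟩ := ih (by omega) w hz' hw0
        have hne : m.degree (r * f k) ≠ m.degree w := by
          intro he
          rw [← he, hdeg] at hh
          exact hr2 _ (m.degree_mem_support hr0) i hi
            (le_of_le_add_disjoint hh (hd i (by omega) k (by omega) (by omega)))
        rcases lt_or_gt_of_ne (fun h => hne (m.toSyn.injective h)) with hl | hl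
        · rw [m.degree_add_eq_right_of_lt hl]
          exact ⟨i, by omega, hh⟩
        · rw [m.degree_add_of_lt hl, hdeg]
          exact ⟨k, by omega, le_add_self⟩

lemma regular_partIdeal (m : MonomialOrder.{u₁, u₃} σ) (f : ℕ → MvPolynomial σ K) (h : ℕ)
    (h0 : ∀ i < h, f i ≠ 0)
    (hd : ∀ i < h, ∀ j < h, i ≠ j → Disjoint (m.degree (f i)).support (m.degree (f j)).support)
    (k : ℕ) (hk : k < h) (g : MvPolynomial σ K) (hg : f k * g ∈ partIdeal f k) :
    g ∈ partIdeal f k := by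
  obtain ⟨r, hr1, hr2⟩ := exists_reduced m f k (fun i hi => h0 i (by omega)) g
  by_cases hr0 : r = 0
  · simpa [hr0] using hr1
  exfalso
  have hfk := h0 k (by omega)
  have hz : r * f k ∈ partIdeal f k := by
    have : r * f k = f k * g - (g - r) * f k := by ring
    rw [this]
    exact Ideal.sub_mem _ hg (Ideal.mul_mem_right _ _ hr1)
  obtain ⟨i, hi, hh⟩ := degree_mem_of_partIdeal m f h h0 hd k hk.le _ hz (mul_ne_zero hr0 hfk)
  rw [m.degree_mul hr0 hfk] at hh
  exact hr2 _ (m.degree_mem_support hr0) i hi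
            (le_of_le_add_disjoint hh (hd i (by omega) k (by omega) (by omega)))

lemma height_ge_of_regular {R : Type*} [CommRing R] (f : ℕ → R) (h : ℕ)
    (hreg : ∀ k < h, ∀ g, f k * g ∈ partIdeal f k → g ∈ partIdeal f k) :
    ∀ k ≤ h, ∀ p : PrimeSpectrum R, partIdeal f k ≤ p.asIdeal → (k : ℕ∞) ≤ Order.height p := by
  intro k
  induction k with
  | zero => intro _ p _; simp
  | succ k ih =>
    intro hk p hp
    obtain ⟨q, hq, hqp⟩ := Ideal.exists_minimalPrimes_le
      ((partIdeal_mono f (Nat.le_succ k)).trans hp)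
    have hqprime := hq.isPrime
    have hfk : f k ∉ q := by
      intro hfq
      obtain ⟨y, hy, hxy⟩ := Ideal.exists_mul_mem_of_mem_minimalPrimes hq hfq
      exact hy (hreg k (by omega) y hxy)
    have hfp : f k ∈ p.asIdeal := hp (Ideal.subset_span ⟨k, Nat.lt_succ_self k, rfl⟩)
    have hlt : (⟨q, hqprime⟩ : PrimeSpectrum R) < p := by
      refine lt_of_le_of_ne hqp ?_
      rintro rfl
      exact hfk hfp
    have := ih (by omega) ⟨q, hqprime⟩ hq.1.2
    push_cast
    exact (add_le_add_left this 1).trans (Order.height_add_one_le hlt)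

lemma isRegular_ofFn (m : MonomialOrder.{u₁, u₃} σ) (f : ℕ → MvPolynomial σ K) (h : ℕ)
    (h0 : ∀ i < h, f i ≠ 0) (h1 : ∀ i < h, m.degree (f i) ≠ 0)
    (hd : ∀ i < h, ∀ j < h, i ≠ j → Disjoint (m.degree (f i)).support (m.degree (f j)).support) :
    RingTheory.Sequence.IsRegular (MvPolynomial σ K) (List.ofFn (fun i : Fin h => f i)) := by
  have key : ∀ k ≤ h, Ideal.ofList ((List.ofFn (fun i : Fin h => f i)).take k) = partIdeal f k := by
    intro k hk
    unfold partIdeal Ideal.ofList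
    congr 1
    ext x
    simp only [Set.mem_ofPred_eq, Set.mem_image, Set.mem_Iio, List.mem_take_iff_getElem,
      List.getElem_ofFn, List.length_ofFn]
    constructor
    · rintro ⟨i, hi, rfl⟩
      exact ⟨i, by omega, rfl⟩
    · rintro ⟨i, hi, rfl⟩
      exact ⟨i, by omega, rfl⟩
  refine ⟨⟨?_⟩, ?_⟩
  · intro i hi
    rw [List.length_ofFn] at hi
    rw [isSMulRegular_quotient_iff_mem_of_smul_mem]
    intro x
    rw [key i hi.le, List.getElem_ofFn, smul_eq_mul, smul_eq_mul, Ideal.mul_top]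
    exact regular_partIdeal m f h h0 hd i hi x
  · have := key h le_rfl
    rw [List.take_of_length_le (by simp)] at this
    rw [this, smul_eq_mul, Ideal.mul_top]
    intro he
    obtain ⟨i, hi, hh⟩ := degree_mem_of_partIdeal m f h h0 hd h le_rfl 1 (he ▸ trivial) one_ne_zero
    rw [m.degree_one] at hh
    exact h1 i hi (le_antisymm hh (by simp))

end KoenigAlgebra

section KoenigUpper

/-- variable attached to a vertex (`1` outside) -/
noncomputable def vtx (K : Type*) [Field K] (P : Finset Cell) (v : Cell) :
    MvPolynomial {v // v ∈ polyVerts P} K :=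
  open Classical in if h : v ∈ polyVerts P then MvPolynomial.X ⟨v, h⟩ else 1

/-- minor attached to a rectangle -/
noncomputable def rmin (K : Type*) [Field K] (P : Finset Cell) (x x' y y' : ℤ) :
    MvPolynomial {v // v ∈ polyVerts P} K :=
  vtx K P (x, y) * vtx K P (x', y') - vtx K P (x, y') * vtx K P (x', y)

lemma rmin_rect (K : Type*) [Field K] (P : Finset Cell)
    (p : Ideal (MvPolynomial {v // v ∈ polyVerts P} K)) [p.IsPrime]
    (hv : ∀ v, vtx K P v ∉ p)
    (hc : ∀ c ∈ P, rmin K P c.1 (c.1 + 1) c.2 (c.2 + 1) ∈ p)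
    (x x' y y' : ℤ) (hx : x < x') (hy : y < y')
    (hin : ∀ c : Cell, x ≤ c.1 → c.1 + 1 ≤ x' → y ≤ c.2 → c.2 + 1 ≤ y' → c ∈ P) :
    rmin K P x x' y y' ∈ p := by
  have hor : ∀ (w : ℕ) (z : ℤ), y ≤ z → z + 1 ≤ y' → x + w + 1 ≤ x' →
      rmin K P x (x + w + 1) z (z + 1) ∈ p := by
    intro w z h1 h2
    induction w with
    | zero =>
      intro h3
      have := hc (x, z) (hin (x, z) le_rfl (by simpa using h3) h1 h2)
      simpa using this
    | succ w ih =>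
      intro h3
      push_cast at h3 ⊢
      have e1 := ih (by linarith)
      have e2 := hc (x + w + 1, z) (hin (x + w + 1, z) (by simp; linarith)
        (by simp; linarith) h1 h2)
      simp only at e2
      have e3 : vtx K P (x + w + 1, z) * rmin K P x (x + (w + 1) + 1) z (z + 1) ∈ p := by
        have : vtx K P (x + w + 1, z) * rmin K P x (x + (w + 1) + 1) z (z + 1) =
          vtx K P (x, z) * rmin K P (x + w + 1) (x + w + 1 + 1) z (z + 1) +
          vtx K P (x + w + 1 + 1, z) * rmin K P x (x + w + 1) z (z + 1) := by
          unfold rmin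
          rw [← add_assoc x (w : ℤ) 1]
          ring
        rw [this]
        exact Ideal.add_mem _ (Ideal.mul_mem_left _ _ e2) (Ideal.mul_mem_left _ _ e1)
      exact (Ideal.IsPrime.mem_or_mem ‹_› e3).resolve_left (hv _)
  have ver : ∀ (w : ℕ), y + w + 1 ≤ y' → rmin K P x x' y (y + w + 1) ∈ p := by
    have hor' : ∀ z : ℤ, y ≤ z → z + 1 ≤ y' → rmin K P x x' z (z + 1) ∈ p := by
      intro z h1 h2
      have := hor (x' - x - 1).toNat z h1 h2
      have e : x + ((x' - x - 1).toNat : ℤ) + 1 = x' := by omega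
      rw [e] at this
      exact this le_rfl
    intro w
    induction w with
    | zero =>
      intro h3
      simpa using hor' y le_rfl (by simpa using h3)
    | succ w ih =>
      intro h3
      push_cast at h3 ⊢
      have e1 := ih (by linarith)
      have e2 := hor' (y + w + 1) (by linarith) (by linarith)
      have e3 : vtx K P (x, y + w + 1) * rmin K P x x' y (y + (w + 1) + 1) ∈ p := by
        have : vtx K P (x, y + w + 1) * rmin K P x x' y (y + (w + 1) + 1) =
          vtx K P (x, y) * rmin K P x x' (y + w + 1) (y + w + 1 + 1) +
          vtx K P (x, y + w + 1 + 1) * rmin K P x x' y (y + w + 1) := by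
          unfold rmin
          rw [← add_assoc y (w : ℤ) 1]
          ring
        rw [this]
        exact Ideal.add_mem _ (Ideal.mul_mem_left _ _ e2) (Ideal.mul_mem_left _ _ e1)
      exact (Ideal.IsPrime.mem_or_mem ‹_› e3).resolve_left (hv _)
  have := ver (y' - y - 1).toNat
  have e : y + ((y' - y - 1).toNat : ℤ) + 1 = y' := by omega
  rw [e] at this
  exact this le_rfl

lemma height_le_card (K : Type*) [Field K] (P : Finset Cell) :
    idealHeight (polyIdeal K P) ≤ (P.card : ℕ∞) := by
  classical
  let s : Finset (MvPolynomial {v // v ∈ polyVerts P} K) :=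
    P.image (fun c => rmin K P c.1 (c.1 + 1) c.2 (c.2 + 1))
  let ev : MvPolynomial {v // v ∈ polyVerts P} K →+* K := MvPolynomial.eval (fun _ => 1)
  have hev : ∀ v, ev (vtx K P v) = 1 := by
    intro v
    unfold vtx
    split_ifs <;> simp [ev]
  have hker : (RingHom.ker ev).IsPrime := RingHom.ker_isPrime ev
  have hle : Ideal.span (s : Set (MvPolynomial {v // v ∈ polyVerts P} K)) ≤ RingHom.ker ev := by
    rw [Ideal.span_le]
    intro x hx
    simp only [s, Finset.coe_image, Set.mem_image] at hx
    obtain ⟨c, -, rfl⟩ := hx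
    simp [RingHom.mem_ker, rmin, hev]
  obtain ⟨p, hp, hpm⟩ := Ideal.exists_minimalPrimes_le hle
  have hpp := hp.isPrime
  have hh : p.height ≤ s.card := Ideal.height_le_card_of_mem_minimalPrimes_span_finset hp
  have hv : ∀ v, vtx K P v ∉ p := by
    intro v hv
    have := hpm hv
    rw [RingHom.mem_ker, hev] at this
    exact one_ne_zero this
  have hI : polyIdeal K P ≤ p := by
    unfold polyIdeal
    rw [Ideal.span_le]
    rintro _ ⟨a, b, c, d, hab, hc, hd, rfl⟩
    have := rmin_rect K P p hv (fun c hc => hp.1.2 (Ideal.subset_span (by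
      simp only [s, Finset.coe_image]
      exact ⟨c, hc, rfl⟩))) a.1.1 b.1.1 a.1.2 b.1.2 hab.1 hab.2.1 hab.2.2
    have e : ∀ w : {v // v ∈ polyVerts P}, MvPolynomial.X w = vtx K P w.1 := by
      intro w
      simp [vtx, w.2]
    rw [e a, e b, e c, e d, hc, hd]
    exact this
  have h2 : idealHeight (polyIdeal K P) ≤ Order.height (⟨p, hpp⟩ : PrimeSpectrum _) :=
    iInf₂_le (⟨p, hpp⟩ : PrimeSpectrum _) hI
  rw [← PrimeSpectrum.height_eq_orderHeight] at h2
  refine h2.trans (hh.trans ?_)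
  exact_mod_cast Finset.card_image_le

end KoenigUpper

section KoenigMinimal

open MvPolynomial

lemma single_pair {α : Type*} {a b c d : α}
    (h : Finsupp.single a 1 + Finsupp.single b 1 = (Finsupp.single c 1 + Finsupp.single d 1 : α →₀ ℕ)) :
    (a = c ∧ b = d) ∨ (a = d ∧ b = c) := by
  classical
  have h' := congrArg Finsupp.toMultiset h
  simp only [map_add, Finsupp.toMultiset_single, one_smul] at h'
  have h2 : a ::ₘ {b} = c ::ₘ {d} := h'
  rw [Multiset.cons_eq_cons] at h2
  rcases h2 with ⟨h3, h4⟩ | ⟨-, cs, h3, h4⟩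
  · exact Or.inl ⟨h3, Multiset.singleton_inj.mp h4⟩
  · rw [Multiset.singleton_eq_cons_iff] at h3 h4
    exact Or.inr ⟨h4.1.symm, h3.1⟩

lemma innerMinors_minimal (K : Type*) [Field K] (P : Finset Cell) (g) (hg : g ∈ innerMinors K P) :
    Ideal.span (innerMinors K P \ {g}) ≠ polyIdeal K P := by
  classical
  intro he
  have hgI : g ∈ Ideal.span (innerMinors K P \ {g}) := he ▸ Ideal.subset_span hg
  obtain ⟨a, b, c, d, hab, hc, hd, rfl⟩ := hg
  set g := (X a * X b - X c * X d : MvPolynomial {v // v ∈ polyVerts P} K) with hgdef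
  have hX : ∀ a b : {v // v ∈ polyVerts P}, (X a * X b : MvPolynomial _ K) =
      monomial (Finsupp.single a 1 + Finsupp.single b 1) 1 := by
    intro a b
    simp [X, monomial_mul]
  have key : ∀ x ∈ Ideal.span (innerMinors K P \ {g}),
      ∀ v ≤ Finsupp.single a 1 + Finsupp.single b 1, coeff v x = 0 := by
    intro x hx
    refine Submodule.span_induction ?_ ?_ ?_ ?_ hx
    · rintro _ ⟨⟨a', b', c', d', hab', hc', hd', rfl⟩, hne⟩ v hv
      have hdeg : ∀ p q : {v // v ∈ polyVerts P}, Finsupp.single p 1 + Finsupp.single q 1 = v →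
          v = Finsupp.single a 1 + Finsupp.single b 1 := by
        intro p q hpq
        obtain ⟨w, hw⟩ := exists_add_of_le hv
        have := congrArg Finsupp.degree hw
        rw [← hpq] at this
        simp only [map_add, Finsupp.degree_single] at this
        have hw0 : Finsupp.degree w = 0 := by omega
        rw [Finsupp.degree_eq_zero_iff] at hw0
        rw [hw, hw0, add_zero]
      rw [hX, hX, coeff_sub, coeff_monomial, coeff_monomial]
      rw [if_neg, if_neg, sub_zero]
      · intro h
        rcases single_pair (h.trans (hdeg _ _ h)) with ⟨h1, h2⟩ | ⟨h1, h2⟩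
        · have := hab.2.1
          have := hab'.2.1
          rw [← h1, ← h2, hc', hd'] at *
          simp_all
          omega
        · have := hab.1
          have := hab'.1
          rw [← h1, ← h2, hc', hd'] at *
          simp_all
          omega
      · intro h
        rcases single_pair (h.trans (hdeg _ _ h)) with ⟨h1, h2⟩ | ⟨h1, h2⟩
        · apply hne
          have e1 : c' = c := Subtype.ext (by rw [hc, hc', h1, h2])
          have e2 : d' = d := Subtype.ext (by rw [hd, hd', h1, h2])
          rw [h1, h2, e1, e2]
          rfl
        · have := hab.1
          have := hab'.1
          rw [h1, h2] at *
          omega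
    · intro v _; simp
    · intro x y _ _ hx hy v hv
      rw [coeff_add, hx v hv, hy v hv, add_zero]
    · intro r x _ hx v hv
      rw [smul_eq_mul, coeff_mul]
      refine Finset.sum_eq_zero fun uv huv => ?_
      rw [Finset.HasAntidiagonal.mem_antidiagonal] at huv
      rw [hx uv.2 (le_trans (by rw [← huv]; exact le_add_self) hv), mul_zero]
  have := key g hgI _ le_rfl
  rw [hgdef, hX, hX, coeff_sub, coeff_monomial, coeff_monomial, if_pos rfl, if_neg] at this
  · simp at this
  · intro h
    have h1 := hab.1
    have h2 := hab.2.1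
    rcases single_pair h with ⟨h3, h4⟩ | ⟨h3, h4⟩
    · rw [← h3, ← h4, hc, hd] at h2
      have := hab.2.1
      simp at h2
      omega
    · rw [← h3, ← h4, hc, hd] at h1
      have := hab.1
      simp at h1
      omega

lemma innerMinors_homog (K : Type*) [Field K] (P : Finset Cell) (g) (hg : g ∈ innerMinors K P) :
    ∃ n, MvPolynomial.IsHomogeneous g n := by
  obtain ⟨a, b, c, d, hab, hc, hd, rfl⟩ := hg
  exact ⟨1 + 1, ((isHomogeneous_X _ _).mul (isHomogeneous_X _ _)).sub
    ((isHomogeneous_X _ _).mul (isHomogeneous_X _ _))⟩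

lemma exists_order {σ : Type u₁} [Finite σ] (r : σ → ℕ) :
    ∃ m : MonomialOrder.{u₁, u₁} σ, ∀ a b c d : σ, r c < r b → r d < r b →
      Finsupp.single c 1 + Finsupp.single d 1 ≺[m] Finsupp.single a 1 + Finsupp.single b 1 := by
  classical
  obtain ⟨N, ⟨e⟩⟩ := Finite.exists_equiv_fin σ
  let key : σ → (ℕ ×ₗ ℕ)ᵒᵈ := fun v => OrderDual.toDual (toLex (r v, (e v : ℕ)))
  have hinj : Function.Injective key := by
    intro u v h
    have h1 : (r u, (e u : ℕ)) = (r v, (e v : ℕ)) := h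
    have h2 := (Prod.mk.inj h1).2
    exact e.injective (Fin.ext h2)
  let _ : LinearOrder σ := LinearOrder.lift' key hinj
  have hlt : ∀ u v : σ, r v < r u → u < v := by
    intro u v h
    change key u < key v
    change toLex (r v, (e v : ℕ)) < toLex (r u, (e u : ℕ))
    rw [Prod.Lex.toLex_lt_toLex]
    exact Or.inl h
  refine ⟨MonomialOrder.lex, ?_⟩
  intro a b c d hc hd
  rw [MonomialOrder.lex_lt_iff, Finsupp.Lex.lt_iff]
  have hc' := hlt _ _ hc
  have hd' := hlt _ _ hd
  refine ⟨min a b, ?_, ?_⟩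
  · intro j hj
    have h1 : j < a := lt_of_lt_of_le hj (min_le_left _ _)
    have h2 : j < b := lt_of_lt_of_le hj (min_le_right _ _)
    have h3 := h2.trans hc'
    have h4 := h2.trans hd'
    simp [h1.ne', h2.ne', h3.ne', h4.ne']
  · have h3 := lt_of_le_of_lt (min_le_right a b) hc'
    have h4 := lt_of_le_of_lt (min_le_right a b) hd'
    simp only [ofLex_toLex, Finsupp.add_apply, Finsupp.single_apply, h3.ne', h4.ne', if_false]
    rcases min_choice a b with h | h <;> rw [h] <;> simp

end KoenigMinimal

section KoenigData

open MvPolynomial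

lemma inner_corners {P : Finset Cell} {a b : Cell} (h : IsInnerInterval P a b) :
    a ∈ polyVerts P ∧ b ∈ polyVerts P ∧ ((a.1, b.2) : Cell) ∈ polyVerts P ∧
      ((b.1, a.2) : Cell) ∈ polyVerts P := by
  obtain ⟨h1, h2, h3⟩ := h
  have c1 := h3 (a.1, a.2) le_rfl (by simp; omega) le_rfl (by simp; omega)
  have c2 := h3 (b.1 - 1, b.2 - 1) (by simp; omega) (by simp) (by simp; omega) (by simp)
  have c3 := h3 (a.1, b.2 - 1) (by simp) (by simp; omega) (by simp; omega) (by simp)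
  have c4 := h3 (b.1 - 1, a.2) (by simp; omega) (by simp) (by simp) (by simp; omega)
  unfold polyVerts
  simp only [Finset.mem_biUnion]
  refine ⟨⟨_, c1, ?_⟩, ⟨_, c2, ?_⟩, ⟨_, c3, ?_⟩, ⟨_, c4, ?_⟩⟩ <;> simp [cellVerts]

lemma minor_of_pair (K : Type*) [Field K] (P : Finset Cell)
    (m : MonomialOrder.{0, 0} {v // v ∈ polyVerts P}) (r : Cell → ℕ)
    (hm : ∀ a b c d : {v // v ∈ polyVerts P}, r c < r b → r d < r b →
      Finsupp.single c 1 + Finsupp.single d 1 ≺[m] Finsupp.single a 1 + Finsupp.single b 1)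
    (p q : Cell) (h1 : p.1 ≠ q.1) (h2 : p.2 ≠ q.2)
    (hin : IsInnerInterval P (min p.1 q.1, min p.2 q.2) (max p.1 q.1, max p.2 q.2))
    (hr1 : r (p.1, q.2) < r q) (hr2 : r (q.1, p.2) < r q) :
    ∃ F ∈ innerMinors K P, F ≠ 0 ∧ ∃ (hp : p ∈ polyVerts P) (hq : q ∈ polyVerts P),
      m.degree F = Finsupp.single ⟨p, hp⟩ 1 + Finsupp.single ⟨q, hq⟩ 1 := by
  classical
  have hX : ∀ a b : {v // v ∈ polyVerts P}, (X a * X b : MvPolynomial _ K) =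
      monomial (Finsupp.single a 1 + Finsupp.single b 1) 1 := by
    intro a b
    simp [X, monomial_mul]
  have hdX : ∀ a b : {v // v ∈ polyVerts P}, m.degree (X a * X b : MvPolynomial _ K) =
      (Finsupp.single a 1 + Finsupp.single b 1) := by
    intro a b
    rw [hX, m.degree_monomial, if_neg one_ne_zero]
  obtain ⟨c1, c2, c3, c4⟩ := inner_corners hin
  simp only at c1 c2 c3 c4
  have hmem : ∀ u v : Cell, u ∈ polyVerts P → u = v → v ∈ polyVerts P := fun u v h e => e ▸ h
  -- the four corners
  have hall : p ∈ polyVerts P ∧ q ∈ polyVerts P ∧ ((p.1, q.2) : Cell) ∈ polyVerts P ∧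
      ((q.1, p.2) : Cell) ∈ polyVerts P := by
    rcases lt_or_gt_of_ne h1 with h1 | h1 <;> rcases lt_or_gt_of_ne h2 with h2 | h2 <;>
    simp only [min_eq_left h1.le, min_eq_right h1.le, max_eq_left h1.le, max_eq_right h1.le,
      min_eq_left h2.le, min_eq_right h2.le, max_eq_left h2.le, max_eq_right h2.le] at c1 c2 c3 c4 <;>
    refine ⟨?_, ?_, ?_, ?_⟩ <;> assumption
  obtain ⟨hp, hq, hs, ht⟩ := hall
  set G : MvPolynomial {v // v ∈ polyVerts P} K :=
    X ⟨p, hp⟩ * X ⟨q, hq⟩ - X ⟨(p.1, q.2), hs⟩ * X ⟨(q.1, p.2), ht⟩ with hG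
  have hdeg : m.degree G = Finsupp.single ⟨p, hp⟩ 1 + Finsupp.single ⟨q, hq⟩ 1 := by
    rw [hG, m.degree_sub_of_lt, hdX]
    rw [hdX, hdX]
    exact hm _ _ _ _ hr1 hr2
  have hG0 : G ≠ 0 := by
    intro h
    rw [h, m.degree_zero] at hdeg
    have := congrArg Finsupp.degree hdeg
    simp only [map_add, Finsupp.degree_single, map_zero] at this
    omega
  have hcase : G ∈ innerMinors K P ∨ -G ∈ innerMinors K P := by
    rcases lt_or_gt_of_ne h1 with h1 | h1 <;> rcases lt_or_gt_of_ne h2 with h2 | h2 <;>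
    simp only [min_eq_left h1.le, min_eq_right h1.le, max_eq_left h1.le, max_eq_right h1.le,
      min_eq_left h2.le, min_eq_right h2.le, max_eq_left h2.le, max_eq_right h2.le] at hin
    · exact Or.inl ⟨⟨p, hp⟩, ⟨q, hq⟩, ⟨_, hs⟩, ⟨_, ht⟩, hin, rfl, rfl, rfl⟩
    · exact Or.inr ⟨⟨_, hs⟩, ⟨_, ht⟩, ⟨p, hp⟩, ⟨q, hq⟩, hin, rfl, rfl, by rw [hG]; ring⟩
    · exact Or.inr ⟨⟨_, ht⟩, ⟨_, hs⟩, ⟨q, hq⟩, ⟨p, hp⟩, hin, rfl, rfl, by rw [hG]; ring⟩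
    · exact Or.inl ⟨⟨q, hq⟩, ⟨p, hp⟩, ⟨_, ht⟩, ⟨_, hs⟩, hin, rfl, rfl, by rw [hG]; ring⟩
  rcases hcase with h | h
  · exact ⟨G, h, hG0, hp, hq, hdeg⟩
  · exact ⟨-G, h, neg_ne_zero.mpr hG0, hp, hq, by rw [m.degree_neg, hdeg]⟩

lemma koenig_of_data (K : Type*) [Field K] (P : Finset Cell) (p q : ℕ → Cell) (r : Cell → ℕ)
    (h1 : ∀ k < P.card, (p k).1 ≠ (q k).1) (h2 : ∀ k < P.card, (p k).2 ≠ (q k).2)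
    (hin : ∀ k < P.card, IsInnerInterval P (min (p k).1 (q k).1, min (p k).2 (q k).2)
      (max (p k).1 (q k).1, max (p k).2 (q k).2))
    (hr1 : ∀ k < P.card, r ((p k).1, (q k).2) < r (q k))
    (hr2 : ∀ k < P.card, r ((q k).1, (p k).2) < r (q k))
    (hd : ∀ i < P.card, ∀ j < P.card, i ≠ j → p i ≠ p j ∧ q i ≠ q j ∧ p i ≠ q j) :
    IsKoenigType (polyIdeal K P) := by
  classical
  obtain ⟨m, hm⟩ := exists_order (fun v : {v // v ∈ polyVerts P} => r v)
  have hex : ∀ k, ∃ F : MvPolynomial {v // v ∈ polyVerts P} K, k < P.card →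
      F ∈ innerMinors K P ∧ F ≠ 0 ∧ ∃ (hp : p k ∈ polyVerts P) (hq : q k ∈ polyVerts P),
      m.degree F = Finsupp.single ⟨p k, hp⟩ 1 + Finsupp.single ⟨q k, hq⟩ 1 := by
    intro k
    by_cases hk : k < P.card
    · obtain ⟨F, hF⟩ := minor_of_pair K P m r hm (p k) (q k) (h1 k hk) (h2 k hk) (hin k hk)
        (hr1 k hk) (hr2 k hk)
      exact ⟨F, fun _ => hF⟩
    · exact ⟨0, fun h => absurd h hk⟩
  choose F hF using hex
  have hF0 : ∀ i < P.card, F i ≠ 0 := fun i hi => (hF i hi).2.1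
  have hFd : ∀ i < P.card, m.degree (F i) ≠ 0 := by
    intro i hi h
    obtain ⟨-, -, hp, hq, hdeg⟩ := hF i hi
    rw [h] at hdeg
    have := congrArg Finsupp.degree hdeg
    simp only [map_add, Finsupp.degree_single, map_zero] at this
    omega
  have hdis : ∀ i < P.card, ∀ j < P.card, i ≠ j →
      Disjoint (m.degree (F i)).support (m.degree (F j)).support := by
    intro i hi j hj hij
    obtain ⟨-, -, hp, hq, hdeg⟩ := hF i hi
    obtain ⟨-, -, hp', hq', hdeg'⟩ := hF j hj
    have e1 := hd i hi j hj hij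
    have e2 := hd j hj i hi hij.symm
    rw [hdeg, hdeg', Finset.disjoint_left]
    intro x hx hx'
    have hx1 : x = ⟨p i, hp⟩ ∨ x = ⟨q i, hq⟩ := by
      by_contra hcon
      push Not at hcon
      simp [Finsupp.single_apply, hcon.1.symm, hcon.2.symm] at hx
    have hx2 : x = ⟨p j, hp'⟩ ∨ x = ⟨q j, hq'⟩ := by
      by_contra hcon
      push Not at hcon
      simp [Finsupp.single_apply, hcon.1.symm, hcon.2.symm] at hx'
    rcases hx1 with rfl | rfl <;> rcases hx2 with h | h <;> have h' := congrArg Subtype.val h <;>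
      simp only at h'
    · exact e1.1 h'
    · exact e1.2.2 h'
    · exact e2.2.2 h'.symm
    · exact e1.2.1 h'
  refine ⟨P.card, le_antisymm (height_le_card K P) ?_, fun i => F i, innerMinors K P, ?_,
    fun i => (hF i i.2).1, innerMinors_homog K P, rfl, innerMinors_minimal K P, m,
    fun i => m.leadingTerm (F i), ?_, ?_⟩
  · refine le_iInf₂ fun p hp => ?_
    refine height_ge_of_regular F P.card (regular_partIdeal m F P.card hF0 hdis) P.card le_rfl p ?_
    refine le_trans ?_ hp
    unfold partIdeal
    rw [Ideal.span_le]
    rintro _ ⟨i, hi, rfl⟩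
    exact Ideal.subset_span (hF i hi).1
  · intro i j hij
    by_contra hne
    have := hdis i i.2 j j.2 (fun h => hne (Fin.ext h))
    simp only at hij
    rw [hij, disjoint_self] at this
    exact hFd j j.2 (Finsupp.support_eq_empty.mp this)
  · intro i
    exact ⟨m.degree (F i), m.degree_mem_support (hF0 i i.2), fun e he => m.le_degree he, rfl⟩
  · refine isRegular_ofFn m (fun i => m.leadingTerm (F i)) P.card ?_ ?_ ?_
    · intro i hi
      rw [Ne, m.leadingTerm_eq_zero_iff]
      exact hF0 i hi
    · intro i hi
      rw [m.degree_leadingTerm]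
      exact hFd i hi
    · intro i hi j hj hij
      rw [m.degree_leadingTerm, m.degree_leadingTerm]
      exact hdis i hi j hj hij

end KoenigData

section Combi

structure CP (n : ℕ) (B : ℕ → Cell) (P : Finset Cell) : Prop where
  hn : 6 ≤ n
  per : ∀ k, B (k + n) = B k
  adj : ∀ k, EdgeAdj (B k) (B (k + 1))
  ne2 : ∀ k, B (k + 2) ≠ B k
  far : ∀ k t, 3 ≤ t → t + 3 ≤ n →
    (2 ≤ (B (k + t)).1 - (B k).1 ∨ (B (k + t)).1 - (B k).1 ≤ -2 ∨
      2 ≤ (B (k + t)).2 - (B k).2 ∨ (B (k + t)).2 - (B k).2 ≤ -2)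
  mem : ∀ k, B k ∈ P
  card : P.card = n
  top : ∀ k, (B k).2 ≤ (B 0).2
  left : ∀ k, (B k).2 = (B 0).2 → (B 0).1 ≤ (B k).1
  b1 : (B 1).1 = (B 0).1 + 1 ∧ (B 1).2 = (B 0).2
  bl : (B (n - 1)).1 = (B 0).1 ∧ (B (n - 1)).2 = (B 0).2 - 1

def Dv (B : ℕ → Cell) (k : ℕ) : Cell := ((B (k + 1)).1 - (B k).1, (B (k + 1)).2 - (B k).2)

def Sv (B : ℕ → Cell) : ℕ → Cell
  | 0 => (0, 1)
  | k + 1 => if Dv B (k + 1) = Dv B k then Sv B k else Dv B k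

def Fv (B : ℕ → Cell) (k : ℕ) : Cell :=
  ((B (k + 1)).1 + (1 + (Dv B k).1 + (Sv B k).1) / 2,
   (B (k + 1)).2 + (1 + (Dv B k).2 + (Sv B k).2) / 2)

def Gv (B : ℕ → Cell) (k : ℕ) : Cell :=
  ((B (k + 1)).1 + (1 + (Dv B k).1 - (Sv B k).1) / 2,
   (B (k + 1)).2 + (1 + (Dv B k).2 - (Sv B k).2) / 2)

def Hv (B : ℕ → Cell) (k : ℕ) : Cell :=
  ((B k).1 + (1 + (Dv B k).1 + (Sv B k).1) / 2,
   (B k).2 + (1 + (Dv B k).2 + (Sv B k).2) / 2)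

variable {n : ℕ} {B : ℕ → Cell} {P : Finset Cell}

lemma CP.dcases (h : CP n B P) (k : ℕ) :
    ((Dv B k).1 = 0 ∧ ((Dv B k).2 = 1 ∨ (Dv B k).2 = -1)) ∨
    ((Dv B k).2 = 0 ∧ ((Dv B k).1 = 1 ∨ (Dv B k).1 = -1)) := by
  have := h.adj k
  unfold EdgeAdj at this
  simp only [Dv]
  omega

lemma CP.dnext (h : CP n B P) (k : ℕ) :
    ¬ ((Dv B (k+1)).1 = - (Dv B k).1 ∧ (Dv B (k+1)).2 = - (Dv B k).2) := by
  rintro ⟨h1, h2⟩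
  apply h.ne2 k
  simp only [Dv, add_assoc, Nat.reduceAdd] at h1 h2
  ext <;> omega

lemma CP.sstep (k : ℕ) :
    ((Dv B (k+1)).1 = (Dv B k).1 ∧ (Dv B (k+1)).2 = (Dv B k).2 ∧
      (Sv B (k+1)).1 = (Sv B k).1 ∧ (Sv B (k+1)).2 = (Sv B k).2) ∨
    (¬ ((Dv B (k+1)).1 = (Dv B k).1 ∧ (Dv B (k+1)).2 = (Dv B k).2) ∧
      (Sv B (k+1)).1 = (Dv B k).1 ∧ (Sv B (k+1)).2 = (Dv B k).2) := by
  by_cases hh : Dv B (k+1) = Dv B k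
  · left; simp [Sv, hh]
  · right; refine ⟨fun hc => hh (Prod.ext hc.1 hc.2), ?_⟩; simp [Sv, hh]

lemma CP.d0 (h : CP n B P) : (Dv B 0).1 = 1 ∧ (Dv B 0).2 = 0 := by
  have := h.b1
  simp only [Dv]; simp only [zero_add]; omega

lemma CP.state (h : CP n B P) (k : ℕ) :
    ((Dv B k).1 = 0 ∧ ((Dv B k).2 = 1 ∨ (Dv B k).2 = -1) ∧
      (Sv B k).2 = 0 ∧ ((Sv B k).1 = 1 ∨ (Sv B k).1 = -1)) ∨
    ((Dv B k).2 = 0 ∧ ((Dv B k).1 = 1 ∨ (Dv B k).1 = -1) ∧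
      (Sv B k).1 = 0 ∧ ((Sv B k).2 = 1 ∨ (Sv B k).2 = -1)) := by
  induction k with
  | zero => have := h.d0; simp [Sv]; omega
  | succ k ih =>
    have h1 := h.dcases (k+1)
    have h2 := h.dcases k
    have h3 := h.dnext k
    have h4 := CP.sstep (B := B) k
    omega

/-- straight or turn -/
lemma CP.step (h : CP n B P) (k : ℕ) :
    ((Dv B (k+1)).1 = (Dv B k).1 ∧ (Dv B (k+1)).2 = (Dv B k).2 ∧
      (Sv B (k+1)).1 = (Sv B k).1 ∧ (Sv B (k+1)).2 = (Sv B k).2) ∨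
    ((Sv B (k+1)).1 = (Dv B k).1 ∧ (Sv B (k+1)).2 = (Dv B k).2 ∧
      (((Dv B (k+1)).1 = (Sv B k).1 ∧ (Dv B (k+1)).2 = (Sv B k).2) ∨
      ((Dv B (k+1)).1 = -(Sv B k).1 ∧ (Dv B (k+1)).2 = -(Sv B k).2))) := by
  have h1 := h.dcases (k+1)
  have h2 := h.state k
  have h3 := h.dnext k
  have h4 := CP.sstep (B := B) k
  omega

lemma CP.dper (h : CP n B P) (k : ℕ) : Dv B (k + n) = Dv B k := by
  have h1 := h.per k
  have h2 := h.per (k+1)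
  simp only [Dv]
  rw [show k + n + 1 = k + 1 + n by ring, h1, h2]

lemma CP.dlast (h : CP n B P) : (Dv B (n-1)).1 = 0 ∧ (Dv B (n-1)).2 = 1 := by
  have h1 := h.per 0
  have h2 := h.bl
  have h3 := h.hn
  simp only [Dv]
  rw [show n - 1 + 1 = 0 + n by omega, h1]
  omega

lemma CP.sper (h : CP n B P) (k : ℕ) : Sv B (k + n) = Sv B k := by
  induction k with
  | zero =>
    have h1 := h.dlast
    have h2 := h.dper 0
    have h3 := h.d0
    obtain ⟨m, hm⟩ : ∃ m, n = m + 1 := ⟨n - 1, by have := h.hn; omega⟩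
    subst hm
    have h4 := CP.sstep (B := B) m
    simp only [Nat.add_sub_cancel, zero_add] at *
    rw [h2] at h4
    have e0 : Sv B 0 = (0, 1) := rfl
    rw [e0]
    refine Prod.ext ?_ ?_ <;> simp only <;> omega
  | succ k ih =>
    have e : k + 1 + n = k + n + 1 := by ring
    rw [e]
    simp only [Sv]
    rw [← e, h.dper, h.dper, ih]

lemma CP.fper (h : CP n B P) (k : ℕ) : Fv B (k + n) = Fv B k := by
  simp only [Fv, h.dper, h.sper, show k + n + 1 = k + 1 + n by ring, h.per]

lemma CP.gper (h : CP n B P) (k : ℕ) : Gv B (k + n) = Gv B k := by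
  simp only [Gv, h.dper, h.sper, show k + n + 1 = k + 1 + n by ring, h.per]

lemma CP.brel (k : ℕ) : (B (k+1)).1 = (B k).1 + (Dv B k).1 ∧
    (B (k+1)).2 = (B k).2 + (Dv B k).2 := by
  simp only [Dv]; omega

lemma cell_ne {a b : Cell} (h : ¬ (a.1 = b.1 ∧ a.2 = b.2)) : a ≠ b := by
  rintro rfl; exact h ⟨rfl, rfl⟩

lemma CP.ftwo (h : CP n B P) (k : ℕ) :
    2 * (Fv B k).1 = 2 * (B (k+1)).1 + 1 + (Dv B k).1 + (Sv B k).1 ∧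
    2 * (Fv B k).2 = 2 * (B (k+1)).2 + 1 + (Dv B k).2 + (Sv B k).2 ∧
    2 * (Gv B k).1 = 2 * (B (k+1)).1 + 1 + (Dv B k).1 - (Sv B k).1 ∧
    2 * (Gv B k).2 = 2 * (B (k+1)).2 + 1 + (Dv B k).2 - (Sv B k).2 ∧
    2 * (Hv B k).1 = 2 * (B k).1 + 1 + (Dv B k).1 + (Sv B k).1 ∧
    2 * (Hv B k).2 = 2 * (B k).2 + 1 + (Dv B k).2 + (Sv B k).2 := by
  rcases h.state k with ⟨d1, d2 | d2, e1, e2 | e2⟩ | ⟨d1, d2 | d2, e1, e2 | e2⟩ <;>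
    simp only [Fv, Gv, Hv] <;> rw [d1, d2, e1, e2] <;> omega

lemma sep_first {d1 d2 e1 e2 s1 s2 t1 t2 : ℤ}
    (hd : (d1 = 0 ∧ (d2 = 1 ∨ d2 = -1)) ∨ (d2 = 0 ∧ (d1 = 1 ∨ d1 = -1)))
    (he : (e1 = 0 ∧ (e2 = 1 ∨ e2 = -1)) ∨ (e2 = 0 ∧ (e1 = 1 ∨ e1 = -1)))
    (hde : ¬ (e1 = -d1 ∧ e2 = -d2))
    (b1 : s1 + d1 ≤ 1 ∧ s1 - d1 ≤ 1 ∧ -1 ≤ s1 - d1 ∧ -1 ≤ s1 + d1)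
    (b2 : s2 + d2 ≤ 1 ∧ s2 - d2 ≤ 1 ∧ -1 ≤ s2 - d2 ∧ -1 ≤ s2 + d2)
    (c1 : t1 + e1 ≤ 1 ∧ t1 - e1 ≤ 1 ∧ -1 ≤ t1 - e1 ∧ -1 ≤ t1 + e1)
    (c2 : t2 + e2 ≤ 1 ∧ t2 - e2 ≤ 1 ∧ -1 ≤ t2 - e2 ∧ -1 ≤ t2 + e2)
    (q1 : d1 + s1 = 3 * e1 + t1) (q2 : d2 + s2 = 3 * e2 + t2) : False := by
  rcases hd with ⟨rfl, rfl | rfl⟩ | ⟨rfl, rfl | rfl⟩ <;>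
  rcases he with ⟨rfl, rfl | rfl⟩ | ⟨rfl, rfl | rfl⟩ <;> omega

lemma sep_second {d1 d2 e1 e2 f1 f2 s1 s2 t1 t2 : ℤ}
    (hd : (d1 = 0 ∧ (d2 = 1 ∨ d2 = -1)) ∨ (d2 = 0 ∧ (d1 = 1 ∨ d1 = -1)))
    (he : (e1 = 0 ∧ (e2 = 1 ∨ e2 = -1)) ∨ (e2 = 0 ∧ (e1 = 1 ∨ e1 = -1)))
    (hf : (f1 = 0 ∧ (f2 = 1 ∨ f2 = -1)) ∨ (f2 = 0 ∧ (f1 = 1 ∨ f1 = -1)))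
    (hde : ¬ (e1 = -d1 ∧ e2 = -d2)) (hef : ¬ (f1 = -e1 ∧ f2 = -e2))
    (b1 : s1 + d1 ≤ 1 ∧ s1 - d1 ≤ 1 ∧ -1 ≤ s1 - d1 ∧ -1 ≤ s1 + d1)
    (b2 : s2 + d2 ≤ 1 ∧ s2 - d2 ≤ 1 ∧ -1 ≤ s2 - d2 ∧ -1 ≤ s2 + d2)
    (c1 : t1 + f1 ≤ 1 ∧ t1 - f1 ≤ 1 ∧ -1 ≤ t1 - f1 ∧ -1 ≤ t1 + f1)
    (c2 : t2 + f2 ≤ 1 ∧ t2 - f2 ≤ 1 ∧ -1 ≤ t2 - f2 ∧ -1 ≤ t2 + f2)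
    (q1 : d1 + s1 = 2 * e1 + 3 * f1 + t1) (q2 : d2 + s2 = 2 * e2 + 3 * f2 + t2) : False := by
  rcases hd with ⟨rfl, rfl | rfl⟩ | ⟨rfl, rfl | rfl⟩ <;>
  rcases he with ⟨rfl, rfl | rfl⟩ | ⟨rfl, rfl | rfl⟩ <;>
  rcases hf with ⟨rfl, rfl | rfl⟩ | ⟨rfl, rfl | rfl⟩ <;> omega

/-- `v` lies on the front edge of the `k`-th step -/
def OnE (B : ℕ → Cell) (k : ℕ) (v : Cell) : Prop := ∃ s1 s2 : ℤ,
  (s1 + (Dv B k).1 ≤ 1 ∧ s1 - (Dv B k).1 ≤ 1 ∧ -1 ≤ s1 - (Dv B k).1 ∧ -1 ≤ s1 + (Dv B k).1) ∧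
  (s2 + (Dv B k).2 ≤ 1 ∧ s2 - (Dv B k).2 ≤ 1 ∧ -1 ≤ s2 - (Dv B k).2 ∧ -1 ≤ s2 + (Dv B k).2) ∧
  2 * v.1 = 2 * (B (k+1)).1 + 1 + (Dv B k).1 + s1 ∧
  2 * v.2 = 2 * (B (k+1)).2 + 1 + (Dv B k).2 + s2

lemma CP.onE (h : CP n B P) (k : ℕ) : OnE B k (Fv B k) ∧ OnE B k (Gv B k) := by
  obtain ⟨f1, f2, g1, g2, -, -⟩ := h.ftwo k
  have s0 := h.state k
  refine ⟨⟨(Sv B k).1, (Sv B k).2, ?_, ?_, f1, f2⟩,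
    ⟨-(Sv B k).1, -(Sv B k).2, ?_, ?_, by rw [g1]; ring, by rw [g2]; ring⟩⟩ <;> clear f1 f2 g1 g2 <;> omega

lemma CP.onE_first (h : CP n B P) {k : ℕ} {v w : Cell} (hv : OnE B k v) (hw : OnE B (k+1) w) :
    v ≠ w := by
  rintro rfl
  obtain ⟨s1, s2, b1, b2, e1, e2⟩ := hv
  obtain ⟨t1, t2, c1, c2, f1, f2⟩ := hw
  have a1 := CP.brel (B := B) (k+1)
  exact sep_first (h.dcases k) (h.dcases (k+1)) (h.dnext k) b1 b2 c1 c2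
    (by linarith [a1.1]) (by linarith [a1.2])

lemma CP.onE_second (h : CP n B P) {k : ℕ} {v w : Cell} (hv : OnE B k v) (hw : OnE B (k+1+1) w) :
    v ≠ w := by
  rintro rfl
  obtain ⟨s1, s2, b1, b2, e1, e2⟩ := hv
  obtain ⟨t1, t2, c1, c2, f1, f2⟩ := hw
  have a1 := CP.brel (B := B) (k+1)
  have a2 := CP.brel (B := B) (k+1+1)
  exact sep_second (h.dcases k) (h.dcases (k+1)) (h.dcases (k+1+1)) (h.dnext k) (h.dnext (k+1))
    b1 b2 c1 c2 (by linarith [a1.1, a2.1]) (by linarith [a1.2, a2.2])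

lemma CP.ne_one (h : CP n B P) (k t : ℕ) (ht : t = 1 ∨ t = 2) :
    Fv B k ≠ Fv B (k + t) ∧ Fv B k ≠ Gv B (k+t) ∧ Gv B k ≠ Fv B (k+t) ∧ Gv B k ≠ Gv B (k+t) := by
  rcases ht with rfl | rfl
  · have a := h.onE k
    have b := h.onE (k+1)
    exact ⟨h.onE_first a.1 b.1, h.onE_first a.1 b.2, h.onE_first a.2 b.1, h.onE_first a.2 b.2⟩
  · have a := h.onE k
    have b := h.onE (k+1+1)
    exact ⟨h.onE_second a.1 b.1, h.onE_second a.1 b.2, h.onE_second a.2 b.1, h.onE_second a.2 b.2⟩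

lemma CP.ne_mid (h : CP n B P) (k t : ℕ) (ht : 3 ≤ t) (ht2 : t + 3 ≤ n) :
    Fv B k ≠ Fv B (k + t) ∧ Fv B k ≠ Gv B (k+t) ∧ Gv B k ≠ Fv B (k+t) ∧ Gv B k ≠ Gv B (k+t) := by
  have s0 := h.state k
  have s1 := h.state (k+t)
  have f := h.far (k+1) t ht ht2
  rw [show k + 1 + t = k + t + 1 by ring] at f
  refine ⟨cell_ne ?_, cell_ne ?_, cell_ne ?_, cell_ne ?_⟩ <;> simp only [Fv, Gv] <;> omega

lemma CP.ne_all (h : CP n B P) (k t : ℕ) (ht : 0 < t) (ht2 : t < n) :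
    Fv B k ≠ Fv B (k + t) ∧ Fv B k ≠ Gv B (k+t) ∧ Gv B k ≠ Fv B (k+t) ∧ Gv B k ≠ Gv B (k+t) := by
  by_cases h1 : t ≤ 2
  · exact h.ne_one k t (by omega)
  by_cases h2 : t + 3 ≤ n
  · exact h.ne_mid k t (by omega) h2
  have := h.ne_one (k+t) (n-t) (by omega)
  rw [show k + t + (n-t) = k + n by omega, h.fper, h.gper] at this
  exact ⟨this.1.symm, this.2.2.1.symm, this.2.1.symm, this.2.2.2.symm⟩

lemma CP.ne_self (h : CP n B P) (k : ℕ) : Fv B k ≠ Gv B k := by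
  have s0 := h.state k
  apply cell_ne
  simp only [Fv, Gv]; omega

lemma CP.f_ne_f (h : CP n B P) {i j : ℕ} (hi : i < n) (hj : j < n) (hij : i ≠ j) :
    Fv B i ≠ Fv B j := by
  rcases Nat.lt_or_gt_of_ne hij with h1 | h1
  · have := h.ne_all i (j - i) (by omega) (by omega)
    rw [show i + (j-i) = j by omega] at this; exact this.1
  · have := h.ne_all j (i - j) (by omega) (by omega)
    rw [show j + (i-j) = i by omega] at this; exact this.1.symm

lemma CP.g_ne_g (h : CP n B P) {i j : ℕ} (hi : i < n) (hj : j < n) (hij : i ≠ j) :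
    Gv B i ≠ Gv B j := by
  rcases Nat.lt_or_gt_of_ne hij with h1 | h1
  · have := h.ne_all i (j - i) (by omega) (by omega)
    rw [show i + (j-i) = j by omega] at this; exact this.2.2.2
  · have := h.ne_all j (i - j) (by omega) (by omega)
    rw [show j + (i-j) = i by omega] at this; exact this.2.2.2.symm

lemma CP.f_ne_g (h : CP n B P) {i j : ℕ} (hi : i < n) (hj : j < n) :
    Fv B i ≠ Gv B j := by
  rcases lt_trichotomy i j with h1 | h1 | h1
  · have := h.ne_all i (j - i) (by omega) (by omega)
    rw [show i + (j-i) = j by omega] at this; exact this.2.1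
  · rw [h1]; exact h.ne_self j
  · have := h.ne_all j (i - j) (by omega) (by omega)
    rw [show j + (i-j) = i by omega] at this; exact this.2.2.1.symm

set_option maxHeartbeats 1000000 in
/-- the other corners -/
lemma CP.corners (h : CP n B P) (k : ℕ) :
    (((Dv B (k+1)).1 = (Dv B k).1 ∧ (Dv B (k+1)).2 = (Dv B k).2) ∧
      ((((Fv B k).1, (Gv B (k+1)).2) = Fv B (k+1) ∧ ((Gv B (k+1)).1, (Fv B k).2) = Gv B k) ∨
       (((Fv B k).1, (Gv B (k+1)).2) = Gv B k ∧ ((Gv B (k+1)).1, (Fv B k).2) = Fv B (k+1)))) ∨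
    (¬ ((Dv B (k+1)).1 = (Dv B k).1 ∧ (Dv B (k+1)).2 = (Dv B k).2) ∧
      ((((Fv B k).1, (Gv B (k+1)).2) = Fv B (k+1) ∧ ((Gv B (k+1)).1, (Fv B k).2) = Hv B k) ∨
       (((Fv B k).1, (Gv B (k+1)).2) = Hv B k ∧ ((Gv B (k+1)).1, (Fv B k).2) = Fv B (k+1)))) := by
  have a0 := CP.brel (B := B) k
  have a1 := CP.brel (B := B) (k+1)
  have f0 := h.ftwo k
  have f1 := h.ftwo (k+1)
  have s0 := h.state k
  have s1 := h.step k
  simp only [Prod.ext_iff]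
  clear h
  generalize (Dv B k).1 = d10 at *
  generalize (Dv B k).2 = d20 at *
  generalize (Sv B k).1 = s10 at *
  generalize (Sv B k).2 = s20 at *
  generalize (Dv B (k+1)).1 = d11 at *
  generalize (Dv B (k+1)).2 = d21 at *
  generalize (Sv B (k+1)).1 = s11 at *
  generalize (Sv B (k+1)).2 = s21 at *
  generalize (Fv B k).1 = zFvBk1 at *
  generalize (Fv B k).2 = zFvBk2 at *
  generalize (Gv B k).1 = zGvBk1 at *
  generalize (Gv B k).2 = zGvBk2 at *
  generalize (Hv B k).1 = zHvBk1 at *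
  generalize (Hv B k).2 = zHvBk2 at *
  generalize (Fv B (k+1)).1 = zFvBk11 at *
  generalize (Fv B (k+1)).2 = zFvBk12 at *
  generalize (Gv B (k+1)).1 = zGvBk11 at *
  generalize (Gv B (k+1)).2 = zGvBk12 at *
  generalize (Hv B (k+1)).1 = zHvBk11 at *
  generalize (Hv B (k+1)).2 = zHvBk12 at *
  generalize (B k).1 = zBk1 at *
  generalize (B k).2 = zBk2 at *
  generalize (B (k+1)).1 = zBk11 at *
  generalize (B (k+1)).2 = zBk12 at *
  generalize (B (k+1+1)).1 = zBk111 at *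
  generalize (B (k+1+1)).2 = zBk112 at *
  rcases s0 with ⟨d1, d2 | d2, e1, e2 | e2⟩ | ⟨d1, d2 | d2, e1, e2 | e2⟩ <;>
  rcases s1 with s1 | ⟨s1, s2, s3 | s3⟩ <;>
  first
  | (left; refine ⟨by omega, Or.inl ⟨⟨by omega, by omega⟩, by omega, by omega⟩⟩; done)
  | (left; refine ⟨by omega, Or.inr ⟨⟨by omega, by omega⟩, by omega, by omega⟩⟩; done)
  | (right; refine ⟨by omega, Or.inl ⟨⟨by omega, by omega⟩, by omega, by omega⟩⟩; done)
  | (right; refine ⟨by omega, Or.inr ⟨⟨by omega, by omega⟩, by omega, by omega⟩⟩; done)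

lemma CP.hcase (h : CP n B P) (k : ℕ) : Hv B (k+1) = Fv B k ∨
    (Hv B (k+1) = Gv B k ∧ (Sv B (k+1)).1 = (Dv B k).1 ∧ (Sv B (k+1)).2 = (Dv B k).2 ∧
      (Dv B (k+1)).1 = -(Sv B k).1 ∧ (Dv B (k+1)).2 = -(Sv B k).2) := by
  have s0 := h.state k
  have s1 := h.step k
  simp only [Prod.ext_iff, Fv, Gv, Hv]
  omega

lemma coord {b b' d s d' s' f g c : ℤ} (h0 : (d = 0 ∧ (s = 1 ∨ s = -1)) ∨ (s = 0 ∧ (d = 1 ∨ d = -1)))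
    (h1 : (d' = d ∧ s' = s) ∨ (s' = d ∧ (d' = s ∨ d' = -s))) (hb : b' = b + d')
    (hf : 2 * f = 2 * b + 1 + d + s) (hg : 2 * g = 2 * b' + 1 + d' - s') :
    f ≠ g ∧ (min f g ≤ c → c + 1 ≤ max f g → c = b ∨ c = b') := by
  rcases h0 with ⟨rfl, rfl | rfl⟩ | ⟨rfl, rfl | rfl⟩ <;>
  rcases h1 with ⟨rfl, rfl⟩ | ⟨rfl, rfl | rfl⟩ <;>
  refine ⟨by omega, fun _ _ => by omega⟩

lemma CP.inner (h : CP n B P) (k : ℕ) :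
    (Fv B k).1 ≠ (Gv B (k+1)).1 ∧ (Fv B k).2 ≠ (Gv B (k+1)).2 ∧
    IsInnerInterval P (min (Fv B k).1 (Gv B (k+1)).1, min (Fv B k).2 (Gv B (k+1)).2)
      (max (Fv B k).1 (Gv B (k+1)).1, max (Fv B k).2 (Gv B (k+1)).2) := by
  have a1 := CP.brel (B := B) (k+1)
  have s0 := h.state k
  have s1 := h.step k
  have sd := h.dcases (k+1)
  have m1 := h.mem (k+1)
  have m2 := h.mem (k+1+1)
  have f0 := h.ftwo k
  have f1 := h.ftwo (k+1)
  have k1 := fun c => coord (c := c) (by clear a1 s1 sd m1 m2 f0 f1; tauto)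
    (by clear a1 s0 sd m1 m2 f0 f1; tauto) a1.1 f0.1 f1.2.2.1
  have k2 := fun c => coord (c := c) (by clear a1 s1 sd m1 m2 f0 f1; tauto)
    (by clear a1 s0 sd m1 m2 f0 f1; tauto) a1.2 f0.2.1 f1.2.2.2.1
  have n1 := (k1 0).1
  have n2 := (k2 0).1
  refine ⟨n1, n2, min_lt_max.2 n1, min_lt_max.2 n2, ?_⟩
  rintro ⟨c1, c2⟩ h1 h2 h3 h4
  have r1 := (k1 c1).2 h1 h2
  have r2 := (k2 c2).2 h3 h4
  have : (c1 = (B (k+1)).1 ∧ c2 = (B (k+1)).2) ∨ (c1 = (B (k+1+1)).1 ∧ c2 = (B (k+1+1)).2) := by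
    clear k1 k2 f0 f1 s0 s1 n1 n2 h1 h2 h3 h4
    omega
  rcases this with ⟨rfl, rfl⟩ | ⟨rfl, rfl⟩
  · exact m1
  · exact m2

lemma CP.inv (h : CP n B P) (k : ℕ) : (Dv B k).1 = 1 → (Sv B k).2 = -1 →
    ∃ j, (B j).2 = (B k).2 + 1 ∧ (B j).1 ≤ (B k).1 := by
  induction k with
  | zero => intro _ h2; simp [Sv] at h2
  | succ k ih =>
    intro h1 h2
    have a0 := CP.brel (B := B) k
    have s0 := h.state k
    have s1 := h.step k
    by_cases hd : (Dv B k).1 = 1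
    · obtain ⟨j, hj1, hj2⟩ := ih hd (by omega)
      exact ⟨j, by omega, by omega⟩
    · exact ⟨k, by omega, by omega⟩

lemma CP.d1 (h : CP n B P) : (Dv B 1).1 = 1 ∧ (Dv B 1).2 = 0 := by
  have hn := h.hn
  have a0 := CP.brel (B := B) 0
  have a1 := CP.brel (B := B) 1
  have s0 := h.d0
  have s1 := h.dcases 1
  have s2 := h.dnext 0
  have t := h.top 2
  have b := h.bl
  have f := h.far 2 (n - 3) (by omega) (by omega)
  rw [show 2 + (n - 3) = n - 1 by omega] at f
  simp only [zero_add, Nat.reduceAdd] at *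
  omega

lemma CP.hlast (h : CP n B P) : Hv B (n - 1) = Fv B (n - 2) := by
  have hn := h.hn
  obtain ⟨m, rfl⟩ : ∃ m, n = m + 2 := ⟨n - 2, by omega⟩
  have l := h.dlast
  have b := h.bl
  rw [show m + 2 - 1 = m + 1 by omega] at *
  rw [show m + 2 - 2 = m by omega]
  rcases h.hcase m with hh | ⟨-, h1, h2, h3, h4⟩
  · exact hh
  exfalso
  have a0 := CP.brel (B := B) m
  have st := h.state m
  by_cases hd : (Dv B m).1 = 1
  · obtain ⟨j, j1, j2⟩ := h.inv m hd (by omega)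
    have := h.left j (by omega)
    omega
  · have f := h.far 1 (m - 1) (by omega) (by omega)
    rw [show 1 + (m - 1) = m by omega] at f
    have := h.b1
    omega

open Classical in
noncomputable def rk (n : ℕ) (B : ℕ → Cell) (v : Cell) : ℕ :=
  if h : ∃ k, k < n ∧ v = Gv B k then h.choose + 1 else 0

lemma CP.rk_g (h : CP n B P) {k : ℕ} (hk : k < n) : rk n B (Gv B k) = k + 1 := by
  have hex : ∃ j, j < n ∧ Gv B k = Gv B j := ⟨k, hk, rfl⟩
  unfold rk
  rw [dif_pos hex]
  have := hex.choose_spec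
  by_contra hc
  exact h.g_ne_g hk this.1 (by omega) this.2

lemma CP.rk_f (h : CP n B P) {k : ℕ} (hk : k < n) : rk n B (Fv B k) = 0 := by
  unfold rk
  rw [dif_neg]
  rintro ⟨j, hj, e⟩
  exact h.f_ne_g hk hj e

lemma CP.ranks (h : CP n B P) {k : ℕ} (hk : k < n) :
    rk n B ((Fv B k).1, (Gv B (k+1)).2) < rk n B (Gv B (k+1)) ∧
    rk n B ((Gv B (k+1)).1, (Fv B k).2) < rk n B (Gv B (k+1)) := by
  have hn := h.hn
  by_cases hl : k + 1 < n
  · have e := h.rk_g hl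
    have f1 := h.rk_f hl
    have g0 := h.rk_g hk
    rcases h.corners k with ⟨-, ⟨e1, e2⟩ | ⟨e1, e2⟩⟩ | ⟨hh, hc⟩
    · rw [e1, e2]; omega
    · rw [e1, e2]; omega
    · have hH : rk n B (Hv B k) < k + 2 := by
        cases k with
        | zero => have := h.d1; have := h.d0; simp only [zero_add] at hh; omega
        | succ k =>
          rcases h.hcase k with e | ⟨e, -⟩
          · rw [e, h.rk_f (by omega)]; omega
          · rw [e, h.rk_g (by omega)]; omega
      rcases hc with ⟨e1, e2⟩ | ⟨e1, e2⟩
      · rw [e1, e2]; omega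
      · rw [e1, e2]; omega
  · have hk1 : k + 1 = 0 + n := by omega
    have g0 : rk n B (Gv B (k+1)) = 1 := by rw [hk1, h.gper, h.rk_g (by omega)]
    have f0 : rk n B (Fv B (k+1)) = 0 := by rw [hk1, h.fper, h.rk_f (by omega)]
    have hH : rk n B (Hv B k) = 0 := by
      have := h.hlast
      rw [show k = n - 1 by omega, this, h.rk_f (by omega)]
    have hd : ¬ ((Dv B (k+1)).1 = (Dv B k).1 ∧ (Dv B (k+1)).2 = (Dv B k).2) := by
      rw [hk1, h.dper, show k = n - 1 by omega]
      have := h.d0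
      have := h.dlast
      omega
    rcases h.corners k with ⟨hh, -⟩ | ⟨-, ⟨e1, e2⟩ | ⟨e1, e2⟩⟩
    · exact absurd hh hd
    · rw [e1, e2]; omega
    · rw [e1, e2]; omega

lemma CP.koenig (K : Type*) [Field K] (h : CP n B P) : IsKoenigType (polyIdeal K P) := by
  have hn := h.hn
  apply koenig_of_data K P (Fv B) (fun k => Gv B (k+1)) (rk n B) <;> rw [h.card]
  · intro k _; exact (h.inner k).1
  · intro k _; exact (h.inner k).2.1
  · intro k _; exact (h.inner k).2.2
  · intro k hk; exact (h.ranks hk).1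
  · intro k hk; exact (h.ranks hk).2
  · have key : ∀ i < n, ∃ i' < n, Gv B (i+1) = Gv B i' ∧ ((i + 1 < n ∧ i' = i + 1) ∨ (i + 1 = n ∧ i' = 0)) := by
      intro i hi
      by_cases hl : i + 1 < n
      · exact ⟨i+1, hl, rfl, Or.inl ⟨hl, rfl⟩⟩
      · refine ⟨0, by omega, ?_, Or.inr ⟨by omega, rfl⟩⟩
        rw [show i + 1 = 0 + n by omega, h.gper]
    intro i hi j hj hij
    obtain ⟨i', hi', ei, ci⟩ := key i hi
    obtain ⟨j', hj', ej, cj⟩ := key j hj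
    refine ⟨h.f_ne_f hi hj hij, ?_, ?_⟩
    · show Gv B (i+1) ≠ Gv B (j+1)
      rw [ei, ej]
      exact h.g_ne_g hi' hj' (by omega)
    · show Fv B i ≠ Gv B (j+1)
      rw [ej]
      exact h.f_ne_g hi hj'

lemma far_of_disj {a b : Cell} (h : cellVerts a ∩ cellVerts b = ∅) :
    (2 ≤ b.1 - a.1 ∨ b.1 - a.1 ≤ -2 ∨ 2 ≤ b.2 - a.2 ∨ b.2 - a.2 ≤ -2) := by
  by_contra hc
  have : ((max a.1 b.1, max a.2 b.2) : Cell) ∈ cellVerts a ∩ cellVerts b := by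
    simp only [cellVerts, Finset.mem_inter, Finset.mem_insert, Finset.mem_singleton, Prod.ext_iff]
    omega
  rw [h] at this
  simp at this

lemma EdgeAdj.symm' {a b : Cell} (h : EdgeAdj a b) : EdgeAdj b a := by
  unfold EdgeAdj at *; omega

lemma seq_reverse {n : ℕ} {A : ZMod n → Cell} (h : IsClosedPathSeq n A P) :
    IsClosedPathSeq n (fun i => A (-i)) P := by
  obtain ⟨h1, h2, h3, h4⟩ := h
  refine ⟨?_, ?_, ?_, ?_⟩
  · intro i
    have := h1 (-(i+1))
    rw [show -(i+1) + 1 = -i by ring] at this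
    exact this.symm'
  · intro i j hij
    exact neg_injective (h2 hij)
  · intro i j hij
    apply h3
    intro hc
    apply hij
    simp only [Set.mem_insert_iff, Set.mem_singleton_iff] at hc ⊢
    rcases hc with hc | hc | hc | hc | hc <;>
      rw [neg_eq_iff_eq_neg] at hc <;> subst hc <;> ring_nf <;> simp
  · rw [h4]
    ext v
    constructor
    · rintro ⟨i, rfl⟩; exact ⟨-i, by simp⟩
    · rintro ⟨i, rfl⟩; exact ⟨-i, rfl⟩

lemma zmod_ne {n : ℕ} {s t : ℕ} (hs : s < n) (ht : t < n) (hst : s ≠ t) : (s : ZMod n) ≠ t := by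
  intro hc
  rw [ZMod.natCast_eq_natCast_iff'] at hc
  rw [Nat.mod_eq_of_lt hs, Nat.mod_eq_of_lt ht] at hc
  exact hst hc

lemma cp_of_seq {n : ℕ} (hn : 5 < n) {A : ZMod n → Cell} (h : IsClosedPathSeq n A P) (c : ZMod n)
    (top : ∀ k, (A k).2 ≤ (A c).2) (left : ∀ k, (A k).2 = (A c).2 → (A c).1 ≤ (A k).1)
    (b1 : (A (c+1)).1 = (A c).1 + 1 ∧ (A (c+1)).2 = (A c).2)
    (bl : (A (c-1)).1 = (A c).1 ∧ (A (c-1)).2 = (A c).2 - 1) :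
    CP n (fun k => A (c + k)) P := by
  obtain ⟨h1, h2, h3, h4⟩ := h
  have : NeZero n := ⟨by omega⟩
  constructor
  · omega
  · intro k; simp
  · intro k
    have := h1 (c + k)
    simpa [add_assoc] using this
  · intro k hk
    have := h2 hk
    have h5 := zmod_ne (n := n) (s := 2) (t := 0) (by omega) (by omega) (by omega)
    apply h5
    push_cast at this ⊢
    linear_combination this
  · intro k t ht ht2
    apply far_of_disj
    apply h3
    intro hc
    simp only [Set.mem_insert_iff, Set.mem_singleton_iff] at hc
    push_cast at hc
    rcases hc with hc | hc | hc | hc | hc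
    · apply zmod_ne (n := n) (s := t + 2) (t := 0) (by omega) (by omega) (by omega)
      push_cast; linear_combination hc
    · apply zmod_ne (n := n) (s := t + 1) (t := 0) (by omega) (by omega) (by omega)
      push_cast; linear_combination hc
    · apply zmod_ne (n := n) (s := t) (t := 0) (by omega) (by omega) (by omega)
      push_cast; linear_combination hc
    · apply zmod_ne (n := n) (s := t) (t := 1) (by omega) (by omega) (by omega)
      push_cast; linear_combination hc
    · apply zmod_ne (n := n) (s := t) (t := 2) (by omega) (by omega) (by omega)
      push_cast; linear_combination hc
  · intro k
    have : A (c + k) ∈ (P : Set Cell) := by rw [h4]; exact ⟨_, rfl⟩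
    exact this
  · have : (P : Set Cell).ncard = n := by
      rw [h4, ← Set.image_univ, Set.ncard_image_of_injective _ h2, Set.ncard_univ]
      simp
    simpa [Set.ncard_coe_finset] using this
  · intro k; simpa using top _
  · intro k; simpa using left _
  · simpa using b1
  · have e : c + ((n - 1 : ℕ) : ZMod n) = c - 1 := by
      rw [Nat.cast_sub (by omega)]; simp [sub_eq_add_neg]
    simpa [e] using bl

end Combi

/-- If `P` is a closed path polyomino and `K` a field, then the polyomino
ideal `I_P` is of König type. -/
theorem closedPath_koenigType (K : Type*) [Field K] (P : Finset Cell)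
    (hP : IsClosedPath P) :
    IsKoenigType (polyIdeal K P) := by
  obtain ⟨n, hn, A, hA⟩ := hP
  have hmem : ∀ v : Cell, v ∈ P ↔ ∃ i, A i = v := by
    intro v
    have : v ∈ (P : Set Cell) ↔ v ∈ Set.range A := by rw [hA.2.2.2]
    simpa using this
  have hne : P.Nonempty := ⟨A 0, (hmem _).2 ⟨0, rfl⟩⟩
  obtain ⟨v, hv, hvmax⟩ := P.exists_max_image (fun v => v.2) hne
  have hne2 : (P.filter (fun w => w.2 = v.2)).Nonempty := ⟨v, by simp [hv]⟩
  obtain ⟨w, hw, hwmin⟩ := (P.filter (fun w => w.2 = v.2)).exists_min_image (fun v => v.1) hne2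
  rw [Finset.mem_filter] at hw
  obtain ⟨c, hc⟩ := (hmem w).1 hw.1
  have top : ∀ k, (A k).2 ≤ (A c).2 := by
    intro k
    have := hvmax (A k) ((hmem _).2 ⟨k, rfl⟩)
    rw [hc, hw.2]; exact this
  have left : ∀ k, (A k).2 = (A c).2 → (A c).1 ≤ (A k).1 := by
    intro k hk
    rw [hc] at hk ⊢
    exact hwmin (A k) (by rw [Finset.mem_filter]; exact ⟨(hmem _).2 ⟨k, rfl⟩, by rw [hk, hw.2]⟩)
  have a1 := hA.1 c
  have a2 := hA.1 (c - 1)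
  rw [sub_add_cancel] at a2
  have hd : A (c+1) ≠ A (c-1) := by
    intro e
    have e := hA.2.1 e
    apply zmod_ne (n := n) (s := 2) (t := 0) (by omega) (by omega) (by omega)
    push_cast
    linear_combination e
  have hd' : ¬ ((A (c+1)).1 = (A (c-1)).1 ∧ (A (c+1)).2 = (A (c-1)).2) :=
    fun h => hd (Prod.ext h.1 h.2)
  have t1 := top (c+1)
  have t2 := top (c-1)
  have l1 := left (c+1)
  have l2 := left (c-1)
  unfold EdgeAdj at a1 a2
  by_cases hcase : (A (c+1)).1 = (A c).1 + 1 ∧ (A (c+1)).2 = (A c).2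
  · exact (cp_of_seq hn hA c top left hcase (by omega)).koenig K
  · refine (cp_of_seq hn (seq_reverse hA) (-c) ?_ ?_ ?_ ?_).koenig K
    · intro k; simpa using top _
    · intro k; simpa using left _
    · simp only [neg_neg, neg_add_rev, show - (-c + 1) = c - 1 by ring]
      ring_nf at *
      omega
    · simp only [neg_neg, show - (-c - 1) = c + 1 by ring]
      omega
end

section
/- Let P be a closed path polyomino. If P does not contain, up to reflections or rotations, a skew configuration of four consecutive cells (four consecutive cells of the closed path whose lower-left corners are, after a rotation or reflection, (0,0), (1,0), (1,1), (2,1)), then P has an L-configuration in every change of direction, i.e., every change of direction of the closed path belongs to a path of five cells C_1,…,C_5 of P forming an L-configuration. -/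
open scoped MonomialOrder

/-- A unit vector of `ℤ²`. -/
def UnitVec (d : Cell) : Prop :=
  d = (1, 0) ∨ d = (-1, 0) ∨ d = (0, 1) ∨ d = (0, -1)

/-- Two vectors of `ℤ²` are orthogonal. -/
def Orth (d e : Cell) : Prop := d.1 * e.1 + d.2 * e.2 = 0

/-- The closed path sequence `A` contains a skew configuration of four consecutive cells:
four consecutive cells whose lower-left corners are, after a rotation or reflection (and a
translation), `(0,0)`, `(1,0)`, `(1,1)`, `(2,1)`; equivalently, the successive differences of
their lower-left corners are `d, e, d` for two orthogonal unit vectors `d, e`. -/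
def HasSkewConfig {n : ℕ} (A : ZMod n → Cell) : Prop :=
  ∃ (i : ZMod n) (d e : Cell), UnitVec d ∧ UnitVec e ∧ Orth d e ∧
    A (i + 1) = A i + d ∧ A (i + 2) = A (i + 1) + e ∧ A (i + 3) = A (i + 2) + d

/-- The (cyclic) path `A` has a change of direction at `k` : the lower-left corners of the
preceding and following cells differ in both coordinates. -/
def ChangesDirAt {n : ℕ} (A : ZMod n → Cell) (k : ZMod n) : Prop :=
  (A (k - 1)).1 ≠ (A (k + 1)).1 ∧ (A (k - 1)).2 ≠ (A (k + 1)).2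

/-- `C 0, …, C 4` is an L-configuration: a path of five cells where `C 0, C 1, C 2` and
`C 2, C 3, C 4` go in two orthogonal directions. -/
def IsLConfig (C : Fin 5 → Cell) : Prop :=
  ∃ d e : Cell, UnitVec d ∧ UnitVec e ∧ Orth d e ∧
    C 1 = C 0 + d ∧ C 2 = C 1 + d ∧ C 3 = C 2 + e ∧ C 4 = C 3 + e

/-- The closed path `A` with cell set `P` has an L-configuration in every change of
direction: every cell at which the path changes direction belongs to a path of five cells
of `P` forming an L-configuration. -/
def HasLConfigAtEveryChangeOfDir {n : ℕ} (A : ZMod n → Cell) (P : Finset Cell) : Prop :=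
  ∀ k : ZMod n, ChangesDirAt A k →
    ∃ C : Fin 5 → Cell, IsLConfig C ∧ (∀ i, C i ∈ P) ∧ ∃ i, C i = A k
theorem aux_step {c d : Cell} (h : EdgeAdj c d) : ∃ u, UnitVec u ∧ d = c + u := by
  obtain ⟨a, b⟩ := c
  obtain ⟨x, y⟩ := d
  refine ⟨(x - a, y - b), ?_, ?_⟩
  · simp only [EdgeAdj, UnitVec, Prod.mk.injEq] at *
    omega
  · ext <;> simp

theorem aux_split {u v w : Cell} (hu : UnitVec u) (hv : UnitVec v) (hw : UnitVec w)
    (h : Orth u v) : w = u ∨ w = -u ∨ w = v ∨ w = -v := by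
  rcases hu with rfl | rfl | rfl | rfl <;> rcases hv with rfl | rfl | rfl | rfl <;>
    rcases hw with rfl | rfl | rfl | rfl <;> simp [Orth] at *

theorem aux_verts {c u : Cell} (hu : UnitVec u) : cellVerts c ∩ cellVerts (c + u) ≠ ∅ := by
  obtain ⟨a, b⟩ := c
  apply Finset.Nonempty.ne_empty
  rcases hu with rfl | rfl | rfl | rfl
  · exact ⟨(a + 1, b), by simp [cellVerts]⟩
  · exact ⟨(a, b), by simp [cellVerts]⟩
  · exact ⟨(a, b + 1), by simp [cellVerts]⟩
  · exact ⟨(a, b), by simp [cellVerts]⟩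

theorem aux_cast {n : ℕ} (m : ℕ) (h0 : 0 < m) (h : m < n) : (m : ZMod n) ≠ 0 := by
  rw [Ne, ZMod.natCast_eq_zero_iff]
  exact fun hd => absurd (Nat.le_of_dvd h0 hd) (by omega)

theorem aux_far {n : ℕ} (hn : 5 < n) (A : ZMod n → Cell) (P : Finset Cell)
    (hA : IsClosedPathSeq n A P) (i : ZMod n) : cellVerts (A i) ∩ cellVerts (A (i + 3)) = ∅ := by
  apply hA.2.2.1
  have h1 := aux_cast (n := n) 1 (by omega) (by omega)
  have h2 := aux_cast (n := n) 2 (by omega) (by omega)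
  have h3 := aux_cast (n := n) 3 (by omega) (by omega)
  have h4 := aux_cast (n := n) 4 (by omega) (by omega)
  have h5 := aux_cast (n := n) 5 (by omega) (by omega)
  push_cast at h1 h2 h3 h4 h5
  simp only [Set.mem_insert_iff, Set.mem_singleton_iff, not_or]
  refine ⟨fun h => h5 ?_, fun h => h4 ?_, fun h => h3 ?_, fun h => h2 ?_, fun h => h1 ?_⟩ <;>
    linear_combination h

/-- If a closed path polyomino `P` does not contain (up to rotations or
reflections) a skew configuration of four consecutive cells, then it has an
L-configuration in every change of direction. -/
theorem closedPath_LConfig_of_no_skew (P : Finset Cell) (n : ℕ) (hn : 5 < n)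
    (A : ZMod n → Cell) (hA : IsClosedPathSeq n A P) (hskew : ¬ HasSkewConfig A) :
    HasLConfigAtEveryChangeOfDir A P := by
  intro k hk
  obtain ⟨i, rfl⟩ : ∃ i, k = i + 2 := ⟨k - 2, by ring⟩
  have e1 : i + 1 + 1 = i + 2 := by ring
  have e2 : i + 2 + 1 = i + 3 := by ring
  have e3 : i + 3 + 1 = i + 4 := by ring
  have e4 : i + 2 - 1 = i + 1 := by ring
  have e5 : i + 1 + 2 = i + 3 := by ring
  have e6 : i + 1 + 3 = i + 4 := by ring
  have hadj := hA.1
  obtain ⟨u, hu, h1⟩ := aux_step (hadj i)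
  obtain ⟨v, hv, h2⟩ := aux_step (hadj (i + 1))
  obtain ⟨w, hw, h3⟩ := aux_step (hadj (i + 2))
  obtain ⟨x, hx, h4⟩ := aux_step (hadj (i + 3))
  rw [e1] at h2
  rw [e2] at h3
  rw [e3] at h4
  have hvw : Orth v w := by
    unfold ChangesDirAt at hk
    rw [e4, e2, h3, h2] at hk
    rcases hv with rfl | rfl | rfl | rfl <;> rcases hw with rfl | rfl | rfl | rfl <;>
      simp [Orth] at *
  have hwv : Orth w v := by unfold Orth at *; linarith
  have c2 := aux_cast (n := n) 2 (by omega) (by omega)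
  push_cast at c2
  have f1 := aux_far hn A P hA i
  have f2 := aux_far hn A P hA (i + 1)
  rw [e6] at f2
  have huv : u = v := by
    rcases aux_split hv hw hu hvw with h | h | h | h
    · exact h
    · exfalso
      have : A (i + 2) = A i := by rw [h2, h1, h]; abel
      exact c2 (by linear_combination hA.2.1 this)
    · exfalso
      subst h
      exact hskew ⟨i, u, v, hu, hv, hwv, h1, h2, h3⟩
    · exfalso
      have : A (i + 3) = A i + v := by rw [h3, h2, h1, h]; abel
      rw [this] at f1
      exact aux_verts hv f1
  have hxw : x = w := by
    rcases aux_split hv hw hx hvw with h | h | h | h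
    · exfalso
      subst h
      exact hskew ⟨i + 1, x, w, hx, hw, hvw, by rw [e1]; exact h2, by rw [e1, e5]; exact h3,
        by rw [e6, e5]; exact h4⟩
    · exfalso
      have : A (i + 4) = A (i + 1) + w := by rw [h4, h3, h2, h]; abel
      rw [this] at f2
      exact aux_verts hw f2
    · exact h
    · exfalso
      have : A (i + 4) = A (i + 2) := by rw [h4, h3, h]; abel
      exact c2 (by linear_combination hA.2.1 this)
  subst huv hxw
  have hP : ∀ j, A j ∈ P := fun j => by
    have : A j ∈ (P : Set Cell) := by rw [hA.2.2.2]; exact ⟨j, rfl⟩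
    exact this
  refine ⟨![A i, A (i + 1), A (i + 2), A (i + 3), A (i + 4)],
    ⟨u, x, hu, hx, hvw, h1, h2, h3, h4⟩, ?_, 2, rfl⟩
  intro j
  fin_cases j <;> exact hP _
end

section
/- Every closed path polyomino is thin, i.e., it does not contain the square tetromino: there is no point (i,j) ∈ ℤ² such that the four cells with lower-left corners (i,j), (i+1,j), (i,j+1), (i+1,j+1) all belong to P. -/
open scoped MonomialOrder

theorem aux_ne (n : ℕ) (hn : 5 < n) (k : ℕ) (h0 : 0 < k) (h5 : k ≤ 5) : (k : ZMod n) ≠ 0 := by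
  intro h
  rw [ZMod.natCast_eq_zero_iff] at h
  have := Nat.le_of_dvd h0 h
  omega

theorem aux_far_s9 (n : ℕ) (hn : 5 < n) (i j : ZMod n) (hij : j = i + 3) :
    j ∉ ({i - 2, i - 1, i, i + 1, i + 2} : Set (ZMod n)) := by
  have h1 := aux_ne n hn 1 (by norm_num) (by norm_num)
  have h2 := aux_ne n hn 2 (by norm_num) (by norm_num)
  have h3 := aux_ne n hn 3 (by norm_num) (by norm_num)
  have h4 := aux_ne n hn 4 (by norm_num) (by norm_num)
  have h5 := aux_ne n hn 5 (by norm_num) (by norm_num)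
  push_cast at h1 h2 h3 h4 h5
  subst hij
  simp only [Set.mem_insert_iff, Set.mem_singleton_iff]
  rintro (h | h | h | h | h)
  · exact h5 (by linear_combination h)
  · exact h4 (by linear_combination h)
  · exact h3 (by linear_combination h)
  · exact h2 (by linear_combination h)
  · exact h1 (by linear_combination h)

/-- Every closed path polyomino is thin: it does not contain the square
tetromino. -/
theorem closedPath_thin (P : Finset Cell) (hP : IsClosedPath P) :
    ¬ ∃ x : Cell, x ∈ P ∧ ((x.1 + 1, x.2) : Cell) ∈ P ∧ ((x.1, x.2 + 1) : Cell) ∈ P ∧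
      ((x.1 + 1, x.2 + 1) : Cell) ∈ P := by
  rintro ⟨x, ha, hb, hc, hd⟩
  obtain ⟨n, hn, A, -, -, hV, hR⟩ := hP
  rw [← Finset.mem_coe, hR] at ha hb hc hd
  obtain ⟨a, ha⟩ := ha
  obtain ⟨b, hb⟩ := hb
  obtain ⟨c, hc⟩ := hc
  obtain ⟨d, hd⟩ := hd
  have near : ∀ i j : ZMod n, (x.1 + 1, x.2 + 1) ∈ cellVerts (A i) →
      (x.1 + 1, x.2 + 1) ∈ cellVerts (A j) →
      j ∈ ({i - 2, i - 1, i, i + 1, i + 2} : Set (ZMod n)) := by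
    intro i j hi hj
    by_contra h
    have := Finset.mem_inter.2 ⟨hi, hj⟩
    rw [hV i j h] at this
    simp at this
  have no3 : ∀ i j : ZMod n, (x.1 + 1, x.2 + 1) ∈ cellVerts (A i) →
      (x.1 + 1, x.2 + 1) ∈ cellVerts (A j) → j ≠ i + 3 :=
    fun i j hi hj h => aux_far_s9 n hn i j h (near i j hi hj)
  have va : (x.1 + 1, x.2 + 1) ∈ cellVerts (A a) := by rw [ha]; simp [cellVerts]
  have vb : (x.1 + 1, x.2 + 1) ∈ cellVerts (A b) := by rw [hb]; simp [cellVerts]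
  have vc : (x.1 + 1, x.2 + 1) ∈ cellVerts (A c) := by rw [hc]; simp [cellVerts]
  have vd : (x.1 + 1, x.2 + 1) ∈ cellVerts (A d) := by rw [hd]; simp [cellVerts]
  have ab : b ≠ a := by rintro rfl; rw [ha] at hb; simp [Prod.ext_iff] at hb
  have ac : c ≠ a := by rintro rfl; rw [ha] at hc; simp [Prod.ext_iff] at hc
  have ad : d ≠ a := by rintro rfl; rw [ha] at hd; simp [Prod.ext_iff] at hd
  have bc : b ≠ c := by rintro rfl; rw [hb] at hc; simp at hc
  have bd : b ≠ d := by rintro rfl; rw [hb] at hd; simp at hd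
  have cd : c ≠ d := by rintro rfl; rw [hc] at hd; simp at hd
  have nb := near a b va vb
  have nc := near a c va vc
  have nd := near a d va vd
  have x1 := no3 b c vb vc
  have x2 := no3 c b vc vb
  have x3 := no3 b d vb vd
  have x4 := no3 d b vd vb
  have x5 := no3 c d vc vd
  have x6 := no3 d c vd vc
  clear near no3 va vb vc vd ha hb hc hd hV hR
  simp only [Set.mem_insert_iff, Set.mem_singleton_iff] at nb nc nd
  have e1 : a + 1 = (a - 2) + 3 := by ring
  have e2 : a + 2 = (a - 1) + 3 := by ring
  rcases nb with h | h | h | h | h <;> rcases nc with h' | h' | h' | h' | h' <;>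
    rcases nd with h'' | h'' | h'' | h'' | h'' <;> simp_all only [ne_eq, not_true_eq_false]
end

section
/- Every closed path polyomino is non-simple: if P is a closed path polyomino, then there exist two cells C and D not belonging to P such that no path of cells, none of which belongs to P, connects C to D. -/
open scoped MonomialOrder

def hcross (X Y : ℤ) (a b : Cell) : ZMod 2 :=
  if a.2 = b.2 ∧ a.2 < Y ∧ ((a.1 = X - 1 ∧ b.1 = X) ∨ (a.1 = X ∧ b.1 = X - 1)) then 1 else 0

def gcol (X Y : ℤ) (a : Cell) : ZMod 2 := if a.1 = X ∧ a.2 < Y then 1 else 0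

lemma hcross_horiz (X Y : ℤ) (a b : Cell) (hab : EdgeAdj a b) (ha : a ≠ (X, Y)) (hb : b ≠ (X, Y)) :
    hcross X Y a b + hcross (X + 1) Y a b = gcol X Y a + gcol X Y b := by
  obtain ⟨a1, a2⟩ := a
  obtain ⟨b1, b2⟩ := b
  have h2 : (1 : ZMod 2) + 1 = 0 := by decide
  simp only [EdgeAdj, ne_eq, Prod.mk.injEq] at hab ha hb
  unfold hcross gcol
  dsimp only
  split_ifs <;> first | omega | simp [h2]

lemma hcross_vert (X Y : ℤ) (a b : Cell) (ha : a ≠ (X, Y)) (hb : b ≠ (X, Y)) :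
    hcross X Y a b = hcross X (Y + 1) a b := by
  obtain ⟨a1, a2⟩ := a
  obtain ⟨b1, b2⟩ := b
  simp only [ne_eq, Prod.mk.injEq] at ha hb
  unfold hcross
  dsimp only
  split_ifs <;> first | omega | rfl

def wind (n : ℕ) [NeZero n] (A : ZMod n → Cell) (c : Cell) : ZMod 2 :=
  ∑ i, hcross c.1 c.2 (A i) (A (i + 1))

lemma wind_vert (n : ℕ) [NeZero n] (A : ZMod n → Cell) (X Y : ℤ)
    (h : ∀ i, A i ≠ (X, Y)) : wind n A (X, Y) = wind n A (X, Y + 1) :=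
  Finset.sum_congr rfl fun i _ => hcross_vert X Y _ _ (h i) (h (i + 1))

lemma wind_horiz (n : ℕ) [NeZero n] (A : ZMod n → Cell) (hA : ∀ i, EdgeAdj (A i) (A (i + 1)))
    (X Y : ℤ) (h : ∀ i, A i ≠ (X, Y)) : wind n A (X, Y) = wind n A (X + 1, Y) := by
  have h1 : wind n A (X, Y) + wind n A (X + 1, Y) = 0 := by
    unfold wind
    rw [← Finset.sum_add_distrib]
    rw [Finset.sum_congr rfl fun i _ => hcross_horiz X Y _ _ (hA i) (h i) (h (i + 1))]
    rw [Finset.sum_add_distrib]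
    have e : ∑ i, gcol X Y (A (i + 1)) = ∑ i, gcol X Y (A i) :=
      Equiv.sum_comp (Equiv.addRight (1 : ZMod n)) (fun i => gcol X Y (A i))
    rw [e]
    exact CharTwo.add_self_eq_zero _
  exact CharTwo.add_eq_zero.mp h1

lemma wind_adj (n : ℕ) [NeZero n] (A : ZMod n → Cell) (hA : ∀ i, EdgeAdj (A i) (A (i + 1)))
    (c d : Cell) (hc : ∀ i, A i ≠ c) (hd : ∀ i, A i ≠ d) (h : EdgeAdj c d) :
    wind n A c = wind n A d := by
  obtain ⟨c1, c2⟩ := c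
  obtain ⟨d1, d2⟩ := d
  simp only [EdgeAdj] at h
  rcases h with ⟨rfl, rfl | rfl⟩ | ⟨rfl, rfl | rfl⟩
  · exact (wind_vert n A _ _ hd).symm
  · exact wind_vert n A _ _ hc
  · exact (wind_horiz n A hA _ _ hd).symm
  · exact wind_horiz n A hA _ _ hc

lemma path_const (f : Cell → ZMod 2) (S : Set Cell)
    (hf : ∀ c d, c ∈ S → d ∈ S → EdgeAdj c d → f c = f d) (L : List Cell) :
    ∀ C D, L.head? = some C → L.getLast? = some D → L.IsChain EdgeAdj → (∀ c ∈ L, c ∈ S) →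
      f C = f D := by
  induction L with
  | nil => intro C D h; simp at h
  | cons a L ih =>
    intro C D h1 h2 h3 h4
    cases L with
    | nil => simp at h1 h2; subst h1; subst h2; rfl
    | cons b L =>
      simp only [List.head?_cons, Option.some.injEq] at h1
      subst h1
      rw [List.isChain_cons_cons] at h3
      rw [List.getLast?_cons_cons] at h2
      rw [hf a b (h4 a (by simp)) (h4 b (by simp)) h3.1]
      exact ih b D rfl h2 h3.2 fun c hc => h4 c (List.mem_cons_of_mem _ hc)

theorem closedPath_not_simple (P : Finset Cell) (hP : IsClosedPath P) :
    ∃ C D : Cell, C ∉ P ∧ D ∉ P ∧ ¬ ∃ L, IsCellPath ((P : Set Cell))ᶜ C D L := by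
  obtain ⟨n, hn, A, hadj, hinj, hdis, hPA⟩ := hP
  haveI : NeZero n := ⟨by omega⟩
  have hmem : ∀ c, c ∈ P ↔ ∃ i, A i = c := fun c => by
    rw [← Finset.mem_coe, hPA]; rfl
  have hk : ∀ k : ℕ, 0 < k → k < 6 → (k : ZMod n) ≠ 0 := by
    intro k h1 h2 h
    rw [ZMod.natCast_eq_zero_iff] at h
    have := Nat.le_of_dvd h1 h
    omega
  have k1 : (1 : ZMod n) ≠ 0 := by simpa using hk 1 (by norm_num) (by norm_num)
  have k2 : (2 : ZMod n) ≠ 0 := by simpa using hk 2 (by norm_num) (by norm_num)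
  have k3 : (3 : ZMod n) ≠ 0 := by simpa using hk 3 (by norm_num) (by norm_num)
  have k4 : (4 : ZMod n) ≠ 0 := by simpa using hk 4 (by norm_num) (by norm_num)
  have k5 : (5 : ZMod n) ≠ 0 := by simpa using hk 5 (by norm_num) (by norm_num)
  obtain ⟨m, hmP, hmin⟩ := Finset.exists_min_image P (fun c => toLex (c.2, c.1))
    ⟨A 0, (hmem _).2 ⟨0, rfl⟩⟩
  obtain ⟨i0, hi0⟩ := (hmem _).1 hmP
  obtain ⟨x, y⟩ := m
  have hmin' : ∀ i, y < (A i).2 ∨ (y = (A i).2 ∧ x ≤ (A i).1) := by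
    intro i
    have := hmin (A i) ((hmem _).2 ⟨i, rfl⟩)
    simpa [Prod.Lex.le_iff] using this
  have hnb : A (i0 + 1) ≠ A (i0 - 1) := fun h => by
    have := hinj h
    apply k2
    linear_combination this
  -- disjointness consequences
  have hshare : ∀ (i j : ZMod n), (x + 1, y + 1) ∈ cellVerts (A i) →
      (x + 1, y + 1) ∈ cellVerts (A j) →
      j = i - 2 ∨ j = i - 1 ∨ j = i ∨ j = i + 1 ∨ j = i + 2 := by
    intro i j h1 h2
    by_contra hc
    have := hdis i j (by simpa using hc)
    have h3 := Finset.mem_inter.2 ⟨h1, h2⟩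
    rw [this] at h3
    simp at h3
  have e1 := hadj i0
  have e2 := hadj (i0 - 1)
  rw [sub_add_cancel] at e2
  rw [hi0] at e1 e2
  have m1 := hmin' (i0 + 1)
  have m2 := hmin' (i0 - 1)
  have hcase : (A (i0 + 1) = (x + 1, y) ∧ A (i0 - 1) = (x, y + 1)) ∨
      (A (i0 + 1) = (x, y + 1) ∧ A (i0 - 1) = (x + 1, y)) := by
    generalize A (i0 + 1) = p at *
    generalize A (i0 - 1) = q at *
    obtain ⟨p1, p2⟩ := p
    obtain ⟨q1, q2⟩ := q
    simp only [EdgeAdj, ne_eq, Prod.mk.injEq] at *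
    omega
  have v0 : (x + 1, y + 1) ∈ cellVerts (A i0) := by rw [hi0]; simp [cellVerts]
  have v1 : (x + 1, y + 1) ∈ cellVerts (A (i0 + 1)) := by
    rcases hcase with h | h <;> rw [h.1] <;> simp [cellVerts]
  have v2 : (x + 1, y + 1) ∈ cellVerts (A (i0 - 1)) := by
    rcases hcase with h | h <;> rw [h.2] <;> simp [cellVerts]
  have hD : ∀ j, A j ≠ (x + 1, y + 1) := by
    intro j hj
    have vj : (x + 1, y + 1) ∈ cellVerts (A j) := by rw [hj]; simp [cellVerts]
    rcases hshare i0 j v0 vj with rfl | rfl | rfl | rfl | rfl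
    · rcases hshare _ _ v1 vj with h | h | h | h | h
      · exact k1 (by linear_combination -h)
      · exact k2 (by linear_combination -h)
      · exact k3 (by linear_combination -h)
      · exact k4 (by linear_combination -h)
      · exact k5 (by linear_combination -h)
    · rcases hcase with h | h <;> rw [h.2] at hj <;> simp at hj
    · rw [hi0] at hj; simp at hj
    · rcases hcase with h | h <;> rw [h.1] at hj <;> simp at hj
    · rcases hshare _ _ v2 vj with h | h | h | h | h
      · exact k5 (by linear_combination h)
      · exact k4 (by linear_combination h)
      · exact k3 (by linear_combination h)
      · exact k2 (by linear_combination h)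
      · exact k1 (by linear_combination h)
  have hC : ∀ j, A j ≠ (x, y - 1) := by
    intro j hj
    have := hmin' j
    rw [hj] at this
    dsimp only at this
    omega
  have wC : wind n A (x, y - 1) = 0 := by
    refine Finset.sum_eq_zero fun i _ => ?_
    have := hmin' i
    unfold hcross
    rw [if_neg]
    dsimp only
    omega
  have key : ∀ j, hcross (x + 1) (y + 1) (A j) (A (j + 1)) ≠ 0 →
      (A j = (x, y) ∧ A (j + 1) = (x + 1, y)) ∨ (A j = (x + 1, y) ∧ A (j + 1) = (x, y)) := by
    intro j hj
    unfold hcross at hj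
    have h := (ite_ne_right_iff.1 hj).1
    have := hmin' j
    simp only [Prod.ext_iff]
    omega
  have wD : wind n A (x + 1, y + 1) = 1 := by
    unfold wind
    dsimp only
    rcases hcase with ⟨h1, h2⟩ | ⟨h1, h2⟩
    · rw [Finset.sum_eq_single i0]
      · rw [hi0, h1]; simp [hcross]
      · intro j _ hj
        by_contra hc
        rcases key j hc with ⟨h, _⟩ | ⟨h, h'⟩
        · exact hj (hinj (h.trans hi0.symm))
        · have a1 := hinj (h.trans h1.symm)
          have a2 := hinj (h'.trans hi0.symm)
          exact k2 (by linear_combination a2 - a1)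
      · simp
    · rw [Finset.sum_eq_single (i0 - 1)]
      · rw [sub_add_cancel, hi0, h2]; simp [hcross]
      · intro j _ hj
        by_contra hc
        rcases key j hc with ⟨h, h'⟩ | ⟨h, h'⟩
        · have a1 := hinj (h.trans hi0.symm)
          have a2 := hinj (h'.trans h2.symm)
          exact k2 (by linear_combination a2 - a1)
        · exact hj (hinj (h.trans h2.symm))
      · simp
  have notmem : ∀ c, c ∉ P → ∀ i, A i ≠ c := fun c hc i h => hc ((hmem c).2 ⟨i, h⟩)
  refine ⟨(x, y - 1), (x + 1, y + 1), ?_, ?_, ?_⟩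
  · rw [hmem]; rintro ⟨j, hj⟩; exact hC j hj
  · rw [hmem]; rintro ⟨j, hj⟩; exact hD j hj
  · rintro ⟨L, hh, hl, hch, -, hS⟩
    have := path_const (wind n A) (P : Set Cell)ᶜ
      (fun c d hc hd h => wind_adj n A hadj c d (notmem c (by simpa using hc))
        (notmem d (by simpa using hd)) h) L _ _ hh hl hch hS
    rw [wC, wD] at this
    exact absurd this (by decide)
end
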